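/- arXiv:2303.05781 — 2 statements merged into one kernel-verified Lean document; each statement's English description precedes it below -/
import Mathlib

section
/- If f is strategy-proof and for some peak vector p ∈ Ω^a the set Ω(p) equals {x, y} with x < y, then x and y are contiguous in the range: (x, y) ∩ Ω = ∅. -/
structure Pref (X : Set ℝ) where
  pref : ℝ → ℝ → Prop
  asymm : ∀ x y, pref x y → ¬ pref y x
  trans : ∀ x y z, pref x y → pref y z → pref x z
  total : ∀ x ∈ X, ∀ y ∈ X, x ≠ y → pref x y ∨ pref y x

/-- Single-peaked preference over `X`. -/
def SinglePeaked {X : Set ℝ} (R : Pref X) : Prop :=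
  ∃ ρ ∈ X, ∀ x ∈ X, ∀ y ∈ X, ((ρ ≤ x ∧ x < y) ∨ (y < x ∧ x ≤ ρ)) → R.pref x y

/-- Single-dipped preference over `X`. -/
def SingleDipped {X : Set ℝ} (R : Pref X) : Prop :=
  ∃ δ ∈ X, ∀ x ∈ X, ∀ y ∈ X, ((δ ≤ x ∧ x < y) ∨ (y < x ∧ x ≤ δ)) → R.pref y x

/-- Profiles in the mixed domain: agents in `A` single-peaked, the rest single-dipped. -/
def Admissible {N : Type} (X : Set ℝ) (A : Set N) (R : N → Pref X) : Prop :=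
  ∀ i, (i ∈ A → SinglePeaked (R i)) ∧ (i ∉ A → SingleDipped (R i))

/-- Range Ω of the social choice rule over admissible profiles. -/
def SCRange {N : Type} (X : Set ℝ) (A : Set N) (f : (N → Pref X) → ℝ) : Set ℝ :=
  {x | ∃ R, Admissible X A R ∧ f R = x}

/-- Strategy-proofness on the mixed domain. -/
def StrategyProof {N : Type} [DecidableEq N] (X : Set ℝ) (A : Set N)
    (f : (N → Pref X) → ℝ) : Prop :=
  ∀ R, Admissible X A R → ∀ i (R'i : Pref X),
    Admissible X A (Function.update R i R'i) →
    ¬ (R i).pref (f (Function.update R i R'i)) (f R)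

open Classical in
/-- Group strategy-proofness on the mixed domain. -/
def GroupStrategyProof {N : Type} (X : Set ℝ) (A : Set N)
    (f : (N → Pref X) → ℝ) : Prop :=
  ∀ R, Admissible X A R → ∀ (S : Set N) (R' : N → Pref X),
    Admissible X A (fun j => if j ∈ S then R' j else R j) →
    ¬ (S.Nonempty ∧ ∀ i ∈ S, (R i).pref (f (fun j => if j ∈ S then R' j else R j)) (f R))

/-- `x` is the best element of `Ω` under `R`. -/
def IsBest {X : Set ℝ} (Ω : Set ℝ) (R : Pref X) (x : ℝ) : Prop :=
  x ∈ Ω ∧ ∀ y ∈ Ω, y ≠ x → R.pref x y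

/-- `x` is the worst element of `Ω` under `R`. -/
def IsWorst {X : Set ℝ} (Ω : Set ℝ) (R : Pref X) (x : ℝ) : Prop :=
  x ∈ Ω ∧ ∀ y ∈ Ω, y ≠ x → R.pref y x

/-- `x` is agent `i`'s Ω-restricted peak (if `i ∈ A`) or dip (if `i ∉ A`) at `R`. -/
def OVal {N : Type} {X : Set ℝ} (Ω : Set ℝ) (A : Set N) (R : N → Pref X)
    (i : N) (x : ℝ) : Prop :=
  (i ∈ A ∧ IsBest Ω (R i) x) ∨ (i ∉ A ∧ IsWorst Ω (R i) x)

/-- Two profiles have the same vector of Ω-restricted peaks and dips. -/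
def SameO {N : Type} {X : Set ℝ} (Ω : Set ℝ) (A : Set N) (R R' : N → Pref X) : Prop :=
  ∀ i x, OVal Ω A R i x ↔ OVal Ω A R' i x

/-- Ω(o(R)): outcomes attainable over profiles sharing the Ω-restricted peaks/dips of `R`. -/
def OmegaO {N : Type} (X : Set ℝ) (A : Set N) (f : (N → Pref X) → ℝ)
    (R : N → Pref X) : Set ℝ :=
  {x | ∃ R', Admissible X A R' ∧ SameO (SCRange X A f) A R R' ∧ f R' = x}

/-- Two profiles have the same Ω-restricted peaks of the agents in `A`. -/
def SameP {N : Type} {X : Set ℝ} (Ω : Set ℝ) (A : Set N) (R R' : N → Pref X) : Prop :=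
  ∀ i ∈ A, ∀ x, IsBest Ω (R i) x ↔ IsBest Ω (R' i) x

/-- Ω(p(R)): outcomes attainable over profiles sharing the Ω-restricted peak vector of `R`. -/
def OmegaP {N : Type} (X : Set ℝ) (A : Set N) (f : (N → Pref X) → ℝ)
    (R : N → Pref X) : Set ℝ :=
  {x | ∃ R', Admissible X A R' ∧ SameP (SCRange X A f) A R R' ∧ f R' = x}

/-- Ω(p): outcomes attainable over profiles whose Ω-restricted peak vector is `p`. -/
def OmegaPvec {N : Type} (X : Set ℝ) (A : Set N) (f : (N → Pref X) → ℝ)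
    (p : N → ℝ) : Set ℝ :=
  {x | ∃ R, Admissible X A R ∧ (∀ i ∈ A, IsBest (SCRange X A f) (R i) (p i)) ∧ f R = x}


section helpers
variable {N : Type} [Fintype N] [DecidableEq N] {X : Set ℝ} {A : Set N} {f : (N → Pref X) → ℝ}

/-- Moving from one admissible profile to another agent by agent, keeping an invariant. -/
lemma hop (hSP : StrategyProof X A f) (R R' : N → Pref X)
    (hR : Admissible X A R) (hR' : Admissible X A R') (Ψ Φ : ℝ → Prop)
    (hΨ : ∀ M : N → Pref X, Admissible X A M → (∀ i, M i = R i ∨ M i = R' i) → Ψ (f M))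
    (h0 : Φ (f R))
    (step : ∀ i u w, R i ≠ R' i → Φ u → Ψ u → Ψ w → ¬ (R i).pref w u → ¬ (R' i).pref u w → Φ w) :
    Φ (f R') := by
  classical
  have key : ∀ S : Finset N, Φ (f (fun i => if i ∈ S then R' i else R i)) := by
    intro S
    have adm : ∀ S : Finset N, Admissible X A (fun i => if i ∈ S then R' i else R i) := by
      intro S i
      by_cases h : i ∈ S
      · simpa [h] using hR' i
      · simpa [h] using hR i
    have psi : ∀ S : Finset N, Ψ (f (fun i => if i ∈ S then R' i else R i)) := by
      intro S
      refine hΨ _ (adm S) fun i => ?_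
      by_cases h : i ∈ S <;> simp [h]
    induction S using Finset.induction_on with
    | empty => simpa using h0
    | insert k S hk ih =>
      have e1 : (fun i => if i ∈ insert k S then R' i else R i)
          = Function.update (fun i => if i ∈ S then R' i else R i) k (R' k) := by
        funext i
        by_cases h : i = k
        · subst h; simp
        · simp [h]
      have e2 : (fun i => if i ∈ S then R' i else R i)
          = Function.update (fun i => if i ∈ insert k S then R' i else R i) k (R k) := by
        funext i
        by_cases h : i = k
        · subst h; simp [hk]
        · simp [h]
      by_cases hne : R k = R' k
      · have : (fun i => if i ∈ insert k S then R' i else R i)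
            = (fun i => if i ∈ S then R' i else R i) := by
          funext i
          by_cases h : i = k
          · subst h; simp [hk, hne]
          · simp [h]
        rw [this]; exact ih
      · refine step k _ _ hne ih (psi S) (psi (insert k S)) ?_ ?_
        · have := hSP _ (adm S) k (R' k) (by rw [← e1]; exact adm _)
          rw [← e1] at this
          simpa [hk] using this
        · have := hSP _ (adm (insert k S)) k (R k) (by rw [← e2]; exact adm _)
          rw [← e2] at this
          simpa using this
  simpa using key Finset.univ

lemma mem_range {R : N → Pref X} (h : Admissible X A R) : f R ∈ SCRange X A f := ⟨R, h, rfl⟩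

lemma hopΩ (hSP : StrategyProof X A f) (R R' : N → Pref X)
    (hR : Admissible X A R) (hR' : Admissible X A R') (Φ : ℝ → Prop)
    (h0 : Φ (f R))
    (step : ∀ i u w, R i ≠ R' i → Φ u → u ∈ SCRange X A f → w ∈ SCRange X A f →
      ¬ (R i).pref w u → ¬ (R' i).pref u w → Φ w) :
    Φ (f R') :=
  hop hSP R R' hR hR' (· ∈ SCRange X A f) Φ (fun M hM _ => mem_range hM) h0 step

open Classical in
/-- Profile built from an `A`-part and a `D`-part. -/
noncomputable def mix (A : Set N) (a d : N → Pref X) : N → Pref X := fun i => if i ∈ A then a i else d i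

def GoodA (A : Set N) (a : N → Pref X) : Prop := ∀ i ∈ A, SinglePeaked (a i)
def GoodD (A : Set N) (d : N → Pref X) : Prop := ∀ i, i ∉ A → SingleDipped (d i)

lemma adm_mix {a d : N → Pref X} (ha : GoodA A a) (hd : GoodD A d) : Admissible X A (mix A a d) := by
  intro i
  by_cases h : i ∈ A
  · simpa [mix, h] using ha i h
  · simpa [mix, h] using hd i h

lemma mix_self (R : N → Pref X) : mix A R R = R := by funext i; simp [mix]

lemma adm_goodA {R : N → Pref X} (h : Admissible X A R) : GoodA A R := fun i hi => (h i).1 hi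
lemma adm_goodD {R : N → Pref X} (h : Admissible X A R) : GoodD A R := fun i hi => (h i).2 hi

/-- hop moving only the `A`-part -/
lemma hopA (hSP : StrategyProof X A f) (a a' d : N → Pref X)
    (ha : GoodA A a) (ha' : GoodA A a') (hd : GoodD A d) (Φ : ℝ → Prop)
    (h0 : Φ (f (mix A a d)))
    (step : ∀ i ∈ A, ∀ u w, a i ≠ a' i → Φ u → u ∈ SCRange X A f → w ∈ SCRange X A f →
      ¬ (a i).pref w u → ¬ (a' i).pref u w → Φ w) :
    Φ (f (mix A a' d)) := by
  refine hopΩ hSP _ _ (adm_mix ha hd) (adm_mix ha' hd) Φ h0 ?_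
  intro i u w hne hu hu' hw h1 h2
  by_cases h : i ∈ A
  · simp only [mix, h, if_true] at hne h1 h2
    exact step i h u w hne hu hu' hw h1 h2
  · simp [mix, h] at hne

/-- hop moving only the `D`-part, with extra information `Ψ` about all outcomes on the way -/
lemma hopD (hSP : StrategyProof X A f) (a d d' : N → Pref X)
    (ha : GoodA A a) (hd : GoodD A d) (hd' : GoodD A d') (Ψ Φ : ℝ → Prop)
    (hΨ : ∀ e, GoodD A e → (∀ i, i ∉ A → e i = d i ∨ e i = d' i) → Ψ (f (mix A a e)))
    (h0 : Φ (f (mix A a d)))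
    (step : ∀ i, i ∉ A → ∀ u w, d i ≠ d' i → Φ u → Ψ u → Ψ w →
      ¬ (d i).pref w u → ¬ (d' i).pref u w → Φ w) :
    Φ (f (mix A a d')) := by
  refine hop hSP _ _ (adm_mix ha hd) (adm_mix ha hd') Ψ Φ ?_ h0 ?_
  · intro M hM hMi
    have : M = mix A a M := by
      funext i
      by_cases h : i ∈ A
      · have := hMi i; simpa [mix, h] using this
      · simp [mix, h]
    rw [this]
    refine hΨ M (adm_goodD hM) fun i hi => ?_
    have := hMi i; simpa [mix, hi] using this
  intro i u w hne hu hu' hw h1 h2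
  by_cases h : i ∈ A
  · simp [mix, h] at hne
  · simp only [mix, h, if_false] at hne h1 h2
    exact step i h u w hne hu hu' hw h1 h2

/-- either some level is nonconstant or there is a pivot -/
lemma chain {δ : Type} (F : Finset N → δ → Prop) (h0 : ∃ d, F ∅ d) (h1 : ∃ d, ¬ F Finset.univ d) :
    (∃ S, (∃ d, F S d) ∧ ∃ d, ¬ F S d) ∨
    ∃ S k, k ∉ S ∧ (∀ d, F S d) ∧ ∀ d, ¬ F (insert k S) d := by
  by_contra hc
  push Not at hc
  obtain ⟨hc1, hc2⟩ := hc
  have : ∀ S : Finset N, ∀ d, F S d := by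
    intro S
    induction S using Finset.induction_on with
    | empty => exact hc1 ∅ h0
    | insert k S hk ih => exact hc1 _ (hc2 S k hk ih)
  obtain ⟨d, hd⟩ := h1
  exact hd (this _ d)

/-! ### Modifying preferences outside `X` -/

def pTop (o : ℝ) (R : Pref X) (ho : o ∉ X) : Pref X where
  pref a b := b ≠ o ∧ (a = o ∨ R.pref a b)
  asymm a b := by
    rintro ⟨h1, h2⟩ ⟨h3, h4⟩
    have := R.asymm a b
    tauto
  trans a b c := by
    rintro ⟨h1, h2⟩ ⟨h3, h4⟩
    have := R.trans a b c
    tauto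
  total a ha b hb hab := by
    have := R.total a ha b hb hab
    have h1 : a ≠ o := by rintro rfl; exact ho ha
    have h2 : b ≠ o := by rintro rfl; exact ho hb
    tauto

def pBot (o : ℝ) (R : Pref X) (ho : o ∉ X) : Pref X where
  pref a b := a ≠ o ∧ (b = o ∨ R.pref a b)
  asymm a b := by
    rintro ⟨h1, h2⟩ ⟨h3, h4⟩
    have := R.asymm a b
    tauto
  trans a b c := by
    rintro ⟨h1, h2⟩ ⟨h3, h4⟩
    have := R.trans a b c
    tauto
  total a ha b hb hab := by
    have := R.total a ha b hb hab
    have h1 : a ≠ o := by rintro rfl; exact ho ha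
    have h2 : b ≠ o := by rintro rfl; exact ho hb
    tauto

lemma Pref.irrefl (R : Pref X) (a : ℝ) : ¬ R.pref a a := fun h => R.asymm a a h h

/-- insert `o` directly below `w` -/
def pBelow (o w : ℝ) (R : Pref X) (ho : o ∉ X) (hw : w ≠ o) : Pref X where
  pref a b := (a = o ∧ b ≠ o ∧ R.pref w b) ∨ (a ≠ o ∧ b = o ∧ (a = w ∨ R.pref a w)) ∨
    (a ≠ o ∧ b ≠ o ∧ R.pref a b)
  asymm a b := by
    have := R.asymm a b
    have := R.asymm w b
    have := R.asymm w a
    have := R.irrefl w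
    rintro (h | h | h) (h' | h' | h') <;> grind
  trans a b c := by
    have := R.trans a b c
    have := R.trans a w c
    have := R.trans w b c
    have := R.trans a b w
    have := R.irrefl w
    rintro (h | h | h) (h' | h' | h') <;> grind [R.asymm w b]
  total a ha b hb hab := by
    have := R.total a ha b hb hab
    have h1 : a ≠ o := by rintro rfl; exact ho ha
    have h2 : b ≠ o := by rintro rfl; exact ho hb
    tauto

/-- insert `o` directly above `w` -/
def pAbove (o w : ℝ) (R : Pref X) (ho : o ∉ X) (hw : w ≠ o) : Pref X where
  pref a b := (a = o ∧ b ≠ o ∧ (b = w ∨ R.pref w b)) ∨ (a ≠ o ∧ b = o ∧ R.pref a w) ∨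
    (a ≠ o ∧ b ≠ o ∧ R.pref a b)
  asymm a b := by
    have := R.asymm a b
    have := R.asymm w b
    have := R.asymm w a
    have := R.irrefl w
    rintro (h | h | h) (h' | h' | h') <;> grind
  trans a b c := by
    have := R.trans a b c
    have := R.trans a w c
    have := R.trans w b c
    have := R.trans a b w
    have := R.irrefl w
    rintro (h | h | h) (h' | h' | h') <;> grind [R.asymm w b]
  total a ha b hb hab := by
    have := R.total a ha b hb hab
    have h1 : a ≠ o := by rintro rfl; exact ho ha
    have h2 : b ≠ o := by rintro rfl; exact ho hb
    tauto

def Agree (R R' : Pref X) : Prop := ∀ a ∈ X, ∀ b ∈ X, (R'.pref a b ↔ R.pref a b)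

lemma Agree.sp {R R' : Pref X} (h : Agree R R') (hR : SinglePeaked R) : SinglePeaked R' := by
  obtain ⟨ρ, h1, h2⟩ := hR
  exact ⟨ρ, h1, fun x hx y hy hxy => (h x hx y hy).2 (h2 x hx y hy hxy)⟩

lemma Agree.sd {R R' : Pref X} (h : Agree R R') (hR : SingleDipped R) : SingleDipped R' := by
  obtain ⟨ρ, h1, h2⟩ := hR
  exact ⟨ρ, h1, fun x hx y hy hxy => (h y hy x hx).2 (h2 x hx y hy hxy)⟩

lemma agree_top (o : ℝ) (R : Pref X) (ho : o ∉ X) : Agree R (pTop o R ho) := by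
  intro a ha b hb
  have h1 : a ≠ o := by rintro rfl; exact ho ha
  have h2 : b ≠ o := by rintro rfl; exact ho hb
  simp [pTop, h1, h2]

lemma agree_bot (o : ℝ) (R : Pref X) (ho : o ∉ X) : Agree R (pBot o R ho) := by
  intro a ha b hb
  have h1 : a ≠ o := by rintro rfl; exact ho ha
  have h2 : b ≠ o := by rintro rfl; exact ho hb
  simp [pBot, h1, h2]

lemma agree_below (o w : ℝ) (R : Pref X) (ho : o ∉ X) (hw : w ≠ o) : Agree R (pBelow o w R ho hw) := by
  intro a ha b hb
  have h1 : a ≠ o := by rintro rfl; exact ho ha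
  have h2 : b ≠ o := by rintro rfl; exact ho hb
  simp [pBelow, h1, h2]

lemma agree_above (o w : ℝ) (R : Pref X) (ho : o ∉ X) (hw : w ≠ o) : Agree R (pAbove o w R ho hw) := by
  intro a ha b hb
  have h1 : a ≠ o := by rintro rfl; exact ho ha
  have h2 : b ≠ o := by rintro rfl; exact ho hb
  simp [pAbove, h1, h2]

/-! ### Preferences from block keys -/

/-- preference from a block function and a sign function -/
noncomputable def blk (X : Set ℝ) (b : ℝ → ℤ) (s : ℝ → ℝ) (hs : ∀ t t', b t = b t' → s t = s t' → t = t') :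
    Pref X where
  pref t t' := b t' < b t ∨ (b t' = b t ∧ s t' < s t)
  asymm t t' := by
    rintro (h | h) (h' | h')
    · omega
    · omega
    · omega
    · linarith [h.2, h'.2]
  trans t t' t'' := by
    rintro (h | h) (h' | h')
    · left; omega
    · left; omega
    · left; omega
    · right; exact ⟨h'.1.trans h.1, h'.2.trans h.2⟩
  total t _ t' _ hne := by
    rcases lt_trichotomy (b t) (b t') with h | h | h
    · right; left; exact h
    · rcases lt_trichotomy (s t) (s t') with h' | h' | h'
      · right; right; exact ⟨h, h'⟩
      · exact absurd (hs _ _ h h') hne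
      · left; right; exact ⟨h.symm, h'⟩
    · left; left; exact h

/-- peak `c`, left side preferred -/
noncomputable def LL (X : Set ℝ) (c : ℝ) : Pref X :=
  blk X (fun t => if t ≤ c then 1 else 0) (fun t => if t ≤ c then t else -t) (by
    intro t t'; split_ifs <;> simp)

/-- peak `c`, right side preferred -/
noncomputable def RL (X : Set ℝ) (c : ℝ) : Pref X :=
  blk X (fun t => if c ≤ t then 1 else 0) (fun t => if c ≤ t then -t else t) (by
    intro t t'; split_ifs <;> simp)

lemma LL_iff (c t t' : ℝ) : (LL X c).pref t t' ↔ (t ≤ c ∧ (c < t' ∨ t' < t)) ∨ (c < t ∧ t < t') := by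
  simp only [LL, blk]; split_ifs <;> simp <;> grind

lemma RL_iff (c t t' : ℝ) : (RL X c).pref t t' ↔ (c ≤ t ∧ (t' < c ∨ t < t')) ∨ (t < c ∧ t' < t) := by
  simp only [RL, blk]; split_ifs <;> simp <;> grind

lemma LL_sp {c : ℝ} (hc : c ∈ X) : SinglePeaked (LL X c) := by
  refine ⟨c, hc, fun t _ t' _ h => ?_⟩
  rw [LL_iff]; grind

lemma RL_sp {c : ℝ} (hc : c ∈ X) : SinglePeaked (RL X c) := by
  refine ⟨c, hc, fun t _ t' _ h => ?_⟩
  rw [RL_iff]; grind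

/-- peak `z`, then `[x,z]`, then right, then left of `x` -/
noncomputable def Z1 (X : Set ℝ) (x z : ℝ) : Pref X :=
  blk X (fun t => if z < t then 1 else if x ≤ t then 2 else 0) (fun t => if z < t then -t else t) (by
    intro t t'; split_ifs <;> simp)

noncomputable def Z2 (X : Set ℝ) (y z : ℝ) : Pref X :=
  blk X (fun t => if t < z then 1 else if t ≤ y then 2 else 0) (fun t => if t < z then t else -t) (by
    intro t t'; split_ifs <;> simp)

lemma Z1_iff (x z t t' : ℝ) : (Z1 X x z).pref t t' ↔
    (t ≤ z ∧ x ≤ t ∧ (z < t' ∨ t' < t)) ∨ (z < t ∧ (t < t' ∨ (t' < x ∧ t' ≤ z)))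
      ∨ (t ≤ z ∧ t < x ∧ t' < t) := by
  simp only [Z1, blk]; split_ifs <;> simp <;> grind

lemma Z2_iff (y z t t' : ℝ) : (Z2 X y z).pref t t' ↔
    (z ≤ t ∧ t ≤ y ∧ (t' < z ∨ t < t')) ∨ (t < z ∧ (t' < t ∨ (y < t' ∧ z ≤ t')))
      ∨ (z ≤ t ∧ y < t ∧ t < t') := by
  simp only [Z2, blk]; split_ifs <;> simp <;> grind

lemma Z1_sp {x z : ℝ} (hz : z ∈ X) (hxz : x < z) : SinglePeaked (Z1 X x z) := by
  refine ⟨z, hz, fun t _ t' _ h => ?_⟩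
  rw [Z1_iff]; grind

lemma Z2_sp {y z : ℝ} (hz : z ∈ X) (hzy : z < y) : SinglePeaked (Z2 X y z) := by
  refine ⟨z, hz, fun t _ t' _ h => ?_⟩
  rw [Z2_iff]; grind

/-- dipped: the middle `(x,y)` is worst; `l` and `r` are the blocks of the left and right sides -/
noncomputable def TT (X : Set ℝ) (x y z : ℝ) (l r : ℤ) (hlr : l ≠ r) (hl : 2 ≤ l) (hr : 2 ≤ r) : Pref X :=
  blk X (fun t => if t ≤ x then l else if y ≤ t then r else if t < z then 0 else if t = z then -1 else 1)
    (fun t => if t ≤ x then -t else if y ≤ t then t else if t < z then -t else t) (by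
    intro t t'; split_ifs <;> grind)

lemma TT_sd {x y z : ℝ} {l r : ℤ} (hlr : l ≠ r) (hl : 2 ≤ l) (hr : 2 ≤ r) (hz : z ∈ X) (hxz : x < z) (hzy : z < y) :
    SingleDipped (TT X x y z l r hlr hl hr) := by
  refine ⟨z, hz, fun t _ t' _ h => ?_⟩
  simp only [TT, blk]; split_ifs <;> grind

lemma exists_pk (hX : X.Nonempty) (c : ℝ) : ∃ P : Pref X, SinglePeaked P ∧ ∀ b, b ≠ c → P.pref c b := by
  by_cases hc : c ∈ X
  · refine ⟨LL X c, LL_sp hc, fun b hb => ?_⟩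
    rw [LL_iff]; left; exact ⟨le_rfl, by rcases lt_or_gt_of_ne hb with h | h <;> tauto⟩
  · obtain ⟨q, hq⟩ := hX
    exact ⟨pTop c (LL X q) hc, (agree_top _ _ _).sp (LL_sp hq), fun b hb => ⟨hb, Or.inl rfl⟩⟩

end helpers

section caseThree
variable {N : Type} [Fintype N] [DecidableEq N] {X : Set ℝ} {A : Set N} {f : (N → Pref X) → ℝ}

/-- the dipped agents cannot distinguish the profile `a'` from `a` -/
lemma DH (hSP : StrategyProof X A f) (a a' : N → Pref X) (ha : GoodA A a) (ha' : GoodA A a')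
    (u v : ℝ) (Mid : Set ℝ) (T T' : Pref X) (hT : SingleDipped T) (hT' : SingleDipped T')
    (hV : ∀ d, GoodD A d → f (mix A a d) = u ∨ f (mix A a d) = v)
    (hu : ∃ d, GoodD A d ∧ f (mix A a d) = u)
    (h1 : ∀ d, GoodD A d → f (mix A a d) = u → f (mix A a' d) = u)
    (h2 : ∀ d, GoodD A d → f (mix A a d) = v → f (mix A a' d) ∈ Mid ∨ f (mix A a' d) = v)
    (huM : u ∉ Mid) (hvM : v ∉ Mid) (huv : u ≠ v)
    (T1 : T.pref v u) (T2 : ∀ m ∈ Mid, T.pref u m) (T'1 : T'.pref u v)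
    (hB : ∀ B : Pref X, SingleDipped B → B.pref v u → ∀ m ∈ Mid, B.pref v m)
    (hdec : ∀ B : Pref X, B.pref u v ∨ B.pref v u) :
    ∀ d, GoodD A d → f (mix A a' d) = f (mix A a d) := by
  classical
  intro d hd
  rcases hV d hd with hV0 | hV0
  · rw [hV0, h1 d hd hV0]
  rcases h2 d hd hV0 with hM | hM
  swap
  · rw [hM, hV0]
  exfalso
  set d1 : N → Pref X := fun i => if (d i).pref v u then T else d i with hd1
  set d2 : N → Pref X := fun i => if (d i).pref v u then T' else d i with hd2
  have gd1 : GoodD A d1 := by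
    intro i hi; simp only [hd1]; split_ifs
    · exact hT
    · exact hd i hi
  have gd2 : GoodD A d2 := by
    intro i hi; simp only [hd2]; split_ifs
    · exact hT'
    · exact hd i hi
  have hall : ∀ e, GoodD A e → (f (mix A a' e) = u ∨ f (mix A a' e) = v ∨ f (mix A a' e) ∈ Mid) := by
    intro e he
    rcases hV e he with h | h
    · exact Or.inl (h1 e he h)
    · have := h2 e he h; tauto
  have s1 : ∀ e, GoodD A e → (∀ i, i ∉ A → e i = d i ∨ e i = d1 i) → f (mix A a e) = v := by
    intro e he hei
    refine hopD hSP a d e ha hd he (fun t => t = u ∨ t = v) (· = v) (fun e' he' _ => hV e' he') hV0 ?_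
    intro i hi s w hne hs _ hw ho hn
    rcases hei i hi with h | h
    · exact absurd h.symm hne
    · simp only [hd1] at h
      split_ifs at h with hc
      · rw [h, hs] at hn
        rcases hw with rfl | hw
        · exact absurd T1 hn
        · exact hw
      · exact absurd h.symm hne
  have s2 : f (mix A a' d1) ∈ Mid := by
    refine hopD hSP a' d d1 ha' hd gd1 (fun t => t ∈ Mid ∨ t = v) (· ∈ Mid)
      (fun e he hei => h2 e he (s1 e he hei)) hM ?_
    intro i hi s w hne hs _ hw ho hn
    rcases hw with hw | rfl
    · exact hw
    simp only [hd1] at hne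
    split_ifs at hne with hc
    · exact absurd (hB _ (hd i hi) hc s hs) ho
    · exact absurd rfl hne
  have s3 : f (mix A a' d2) ∈ Mid := by
    refine hopD hSP a' d1 d2 ha' gd1 gd2 (fun t => t = u ∨ t = v ∨ t ∈ Mid) (· ∈ Mid)
      (fun e he hei => hall e he) s2 ?_
    intro i hi s w hne hs _ hw ho hn
    simp only [hd1, hd2] at hne ho
    split_ifs at hne ho with hc
    · rcases hw with rfl | rfl | hw
      · exact absurd (T2 s hs) ho
      · exact absurd (T.trans _ _ _ T1 (T2 s hs)) ho
      · exact hw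
    · exact absurd rfl hne
  obtain ⟨du, gdu, hdu⟩ := hu
  have s4 : f (mix A a d2) = u := by
    refine hopD hSP a du d2 ha gdu gd2 (fun t => t = u ∨ t = v) (· = u) (fun e' he' _ => hV e' he') hdu ?_
    intro i hi s w hne hs _ hw ho hn
    rcases hw with hw | hw
    · exact hw
    exfalso
    apply hn
    rw [hs, hw]
    simp only [hd2]
    split_ifs with hc
    · exact T'1
    · have := hdec (d i); tauto
  rw [h1 d2 gd2 s4] at s3
  exact huM s3

set_option maxHeartbeats 4000000 in
lemma caseThree (hSP : StrategyProof X A f) (p : N → ℝ) (hp : ∀ i ∈ A, p i ∈ SCRange X A f)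
    (x y : ℝ) (hxy : x < y)
    (hpk : ∀ R, Admissible X A R → (∀ i ∈ A, IsBest (SCRange X A f) (R i) (p i)) → f R = x ∨ f R = y)
    (hxa : ∃ R, Admissible X A R ∧ (∀ i ∈ A, IsBest (SCRange X A f) (R i) (p i)) ∧ f R = x)
    (hya : ∃ R, Admissible X A R ∧ (∀ i ∈ A, IsBest (SCRange X A f) (R i) (p i)) ∧ f R = y)
    (hΩ : SCRange X A f ⊆ X) (z : ℝ) (hz : z ∈ SCRange X A f) (hxz : x < z) (hzy : z < y) : False := by
  classical
  obtain ⟨Rx, admx, pkx, fx⟩ := hxa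
  obtain ⟨Ry, admy, pky, fy⟩ := hya
  have hxΩ : x ∈ SCRange X A f := ⟨Rx, admx, fx⟩
  have hyΩ : y ∈ SCRange X A f := ⟨Ry, admy, fy⟩
  set lft : Finset N → N → Prop := fun S i => p i ≤ x ∨ (p i < y ∧ i ∉ S) with hlft
  set a : Finset N → N → Pref X := fun S i => if lft S i then LL X (p i) else RL X (p i) with ha
  have lft_lt : ∀ S i, lft S i → p i < y := by
    intro S i h; simp only [hlft] at h; rcases h with h | h
    · linarith
    · exact h.1
  have rgt_lt : ∀ S i, ¬ lft S i → x < p i := by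
    intro S i h; simp only [hlft] at h; push Not at h; exact h.1
  have ga : ∀ S, GoodA A (a S) := by
    intro S i hi; simp only [ha]; split_ifs
    · exact LL_sp (hΩ (hp i hi))
    · exact RL_sp (hΩ (hp i hi))
  have hV : ∀ S d, GoodD A d → f (mix A (a S) d) = x ∨ f (mix A (a S) d) = y := by
    intro S d hd
    refine hpk _ (adm_mix (ga S) hd) fun i hi => ⟨hp i hi, fun b _ hb => ?_⟩
    simp only [mix, hi, if_true, ha]
    split_ifs
    · rw [LL_iff]; grind
    · rw [RL_iff]; grind
  -- the pair survives single-peakedness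
  have e0 : f (mix A (a ∅) Rx) = x := by
    refine hop hSP Rx _ admx (adm_mix (ga ∅) (adm_goodD admx)) (fun t => t = x ∨ t = y) (· = x) ?_ fx ?_
    · intro M hM hMi
      refine hpk M hM fun i hi => ?_
      rcases hMi i with h | h
      · rw [h]; exact pkx i hi
      · rw [h]
        refine ⟨hp i hi, fun b _ hb => ?_⟩
        simp only [mix, hi, if_true, ha]
        split_ifs
        · rw [LL_iff]; grind
        · rw [RL_iff]; grind
    · intro i u w hne hu _ hw ho hn
      rcases hw with hw | hw
      · exact hw
      exfalso
      by_cases hi : i ∈ A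
      swap
      · simp [mix, hi] at hne
      simp only [mix, hi, if_true, ha] at hn
      by_cases hl : lft ∅ i
      · have := lft_lt _ _ hl
        simp only [hl, if_true] at hn
        rw [LL_iff] at hn; grind
      · have hl' : y ≤ p i := by simp only [hlft] at hl; simp at hl; tauto
        rw [hw, hu] at ho
        apply ho
        obtain ⟨ρ, hρ, hs⟩ := (admx i).1 hi
        have hb := (pkx i hi).2
        have hρy : y ≤ ρ := by
          by_contra hc
          push Not at hc
          rcases eq_or_lt_of_le hl' with h | h
          · have h1 := hb x hxΩ (by linarith)
            rw [← h] at h1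
            exact ho h1
          · have h1 := hb y hyΩ (by linarith)
            exact Pref.asymm _ _ _ h1
              (hs y (hΩ hyΩ) (p i) (hΩ (hp i hi)) (Or.inl ⟨hc.le, h⟩))
        exact hs y (hΩ hyΩ) x (hΩ hxΩ) (Or.inr ⟨hxy, hρy⟩)
  have e1 : f (mix A (a Finset.univ) Ry) = y := by
    refine hop hSP Ry _ admy (adm_mix (ga _) (adm_goodD admy)) (fun t => t = x ∨ t = y) (· = y) ?_ fy ?_
    · intro M hM hMi
      refine hpk M hM fun i hi => ?_
      rcases hMi i with h | h
      · rw [h]; exact pky i hi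
      · rw [h]
        refine ⟨hp i hi, fun b _ hb => ?_⟩
        simp only [mix, hi, if_true, ha]
        split_ifs
        · rw [LL_iff]; grind
        · rw [RL_iff]; grind
    · intro i u w hne hu _ hw ho hn
      rcases hw with hw | hw
      swap
      · exact hw
      exfalso
      by_cases hi : i ∈ A
      swap
      · simp [mix, hi] at hne
      simp only [mix, hi, if_true, ha] at hn
      by_cases hl : lft Finset.univ i
      swap
      · have := rgt_lt _ _ hl
        simp only [hl, if_false] at hn
        rw [RL_iff] at hn; grind
      · have hl' : p i ≤ x := by simpa [hlft] using hl
        rw [hw, hu] at ho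
        apply ho
        obtain ⟨ρ, hρ, hs⟩ := (admy i).1 hi
        have hb := (pky i hi).2
        have hρy : ρ ≤ x := by
          by_contra hc
          push Not at hc
          rcases eq_or_lt_of_le hl' with h | h
          · have h1 := hb y hyΩ (by linarith)
            rw [h] at h1
            exact ho h1
          · have h1 := hb x hxΩ (by linarith)
            exact Pref.asymm _ _ _ h1
              (hs x (hΩ hxΩ) (p i) (hΩ (hp i hi)) (Or.inr ⟨h, hc.le⟩))
        exact hs x (hΩ hxΩ) y (hΩ hyΩ) (Or.inl ⟨hρy, hxy⟩)
  rcases chain (δ := {d : N → Pref X // GoodD A d}) (fun S d => f (mix A (a S) d.1) = x)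
    ⟨⟨Rx, adm_goodD admx⟩, e0⟩ ⟨⟨Ry, adm_goodD admy⟩, by simp only [e1]; exact hxy.ne'⟩ with
    ⟨S, ⟨⟨dx, gdx⟩, hdx⟩, ⟨⟨dy, gdy⟩, hdy⟩⟩ | ⟨S, k, hkS, hall, hnone⟩
  · -- nonconstant level
    obtain ⟨RQ, admQ, fQ⟩ := hz
    have hzΩ : z ∈ SCRange X A f := ⟨RQ, admQ, fQ⟩
    have hzX := hΩ hzΩ
    replace hdy : f (mix A (a S) dy) = y := (hV S dy gdy).resolve_left hdy
    set H : N → Pref X := fun i => if lft S i then LL X (p i) else Z2 X y z with hH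
    set H' : N → Pref X := fun i => if lft S i then Z1 X x z else RL X (p i) with hH'
    set G : N → Pref X := fun i => if lft S i then Z1 X x z else Z2 X y z with hG
    have gH : GoodA A H := by
      intro i hi; simp only [hH]; split_ifs
      · exact LL_sp (hΩ (hp i hi))
      · exact Z2_sp hzX hzy
    have gH' : GoodA A H' := by
      intro i hi; simp only [hH']; split_ifs
      · exact Z1_sp hzX hxz
      · exact RL_sp (hΩ (hp i hi))
    have gG : GoodA A G := by
      intro i hi; simp only [hG]; split_ifs
      · exact Z1_sp hzX hxz
      · exact Z2_sp hzX hzy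
    have hHV : ∀ d, GoodD A d → f (mix A H d) = f (mix A (a S) d) := by
      refine DH hSP (a S) H (ga S) gH x y (SCRange X A f ∩ Set.Ico z y)
        (TT X x y z 2 3 (by norm_num) (by norm_num) (by norm_num))
        (TT X x y z 3 2 (by norm_num) (by norm_num) (by norm_num))
        (TT_sd _ _ _ hzX hxz hzy) (TT_sd _ _ _ hzX hxz hzy) (hV S) ⟨dx, gdx, hdx⟩ ?_ ?_ ?_ ?_ hxy.ne
        ?_ ?_ ?_ ?_ ?_
      · intro d hd h
        refine hopA hSP _ _ d (ga S) gH hd (· = x) h ?_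
        intro i hi u w hne hu _ hw ho hn
        simp only [ha, hH] at hne ho hn
        split_ifs at hne ho hn with hl
        · exact absurd rfl hne
        · have := rgt_lt _ _ hl
          rw [RL_iff] at ho; rw [Z2_iff] at hn; grind
      · intro d hd h
        have : z ≤ f (mix A H d) ∧ f (mix A H d) ≤ y := by
          refine hopA hSP _ _ d (ga S) gH hd (fun t => z ≤ t ∧ t ≤ y) (by rw [h]; exact ⟨hzy.le, le_rfl⟩) ?_
          intro i hi u w hne hu _ hw ho hn
          simp only [ha, hH] at hne ho hn
          split_ifs at hne ho hn with hl
          · exact absurd rfl hne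
          · rw [Z2_iff] at hn; grind
        rcases eq_or_lt_of_le this.2 with h' | h'
        · exact Or.inr h'
        · exact Or.inl ⟨mem_range (adm_mix gH hd), this.1, h'⟩
      · simp only [Set.mem_inter_iff, Set.mem_Ico, not_and, not_lt]; intro _ h; linarith
      · simp
      · simp only [TT, blk]; split_ifs <;> grind
      · rintro m ⟨_, hm1, hm2⟩
        simp only [TT, blk]; split_ifs <;> grind
      · simp only [TT, blk]; split_ifs <;> grind
      · rintro B ⟨δ, hδ, hs⟩ hB m ⟨hm, hm1, hm2⟩
        rcases le_total δ m with h | h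
        · exact hs m (hΩ hm) y (hΩ hyΩ) (Or.inl ⟨h, hm2⟩)
        · exact B.trans _ _ _ hB (hs m (hΩ hm) x (hΩ hxΩ) (Or.inr ⟨by linarith, h⟩))
      · intro B; exact B.total x (hΩ hxΩ) y (hΩ hyΩ) hxy.ne
    have hHV' : ∀ d, GoodD A d → f (mix A H' d) = f (mix A (a S) d) := by
      refine DH hSP (a S) H' (ga S) gH' y x (SCRange X A f ∩ Set.Ioc x z)
        (TT X x y z 3 2 (by norm_num) (by norm_num) (by norm_num))
        (TT X x y z 2 3 (by norm_num) (by norm_num) (by norm_num))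
        (TT_sd _ _ _ hzX hxz hzy) (TT_sd _ _ _ hzX hxz hzy) (fun d hd => (hV S d hd).symm)
        ⟨dy, gdy, hdy⟩ ?_ ?_ ?_ ?_ hxy.ne'
        ?_ ?_ ?_ ?_ ?_
      · intro d hd h
        refine hopA hSP _ _ d (ga S) gH' hd (· = y) h ?_
        intro i hi u w hne hu _ hw ho hn
        simp only [ha, hH'] at hne ho hn
        split_ifs at hne ho hn with hl
        · have := lft_lt _ _ hl
          rw [LL_iff] at ho; rw [Z1_iff] at hn; grind
        · exact absurd rfl hne
      · intro d hd h
        have : x ≤ f (mix A H' d) ∧ f (mix A H' d) ≤ z := by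
          refine hopA hSP _ _ d (ga S) gH' hd (fun t => x ≤ t ∧ t ≤ z) (by rw [h]; exact ⟨le_rfl, hxz.le⟩) ?_
          intro i hi u w hne hu _ hw ho hn
          simp only [ha, hH'] at hne ho hn
          split_ifs at hne ho hn with hl
          · rw [Z1_iff] at hn; grind
          · exact absurd rfl hne
        rcases eq_or_lt_of_le this.1 with h' | h'
        · exact Or.inr h'.symm
        · exact Or.inl ⟨mem_range (adm_mix gH' hd), h', this.2⟩
      · simp only [Set.mem_inter_iff, Set.mem_Ioc, not_and, not_le]; intro _ h; exact hzy
      · simp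
      · simp only [TT, blk]; split_ifs <;> grind
      · rintro m ⟨_, hm1, hm2⟩
        simp only [TT, blk]; split_ifs <;> grind
      · simp only [TT, blk]; split_ifs <;> grind
      · rintro B ⟨δ, hδ, hs⟩ hB m ⟨hm, hm1, hm2⟩
        rcases le_total m δ with h | h
        · exact hs m (hΩ hm) x (hΩ hxΩ) (Or.inr ⟨hm1, h⟩)
        · exact B.trans _ _ _ hB (hs m (hΩ hm) y (hΩ hyΩ) (Or.inl ⟨h, by linarith⟩))
      · intro B; exact B.total y (hΩ hyΩ) x (hΩ hxΩ) hxy.ne'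
    have gQ := adm_goodD admQ
    have hGz : f (mix A G RQ) = z := by
      refine hopA hSP RQ G RQ (adm_goodA admQ) gG gQ (· = z) (by rw [mix_self]; exact fQ) ?_
      intro i hi u w hne hu _ hw ho hn
      simp only [hG] at hn
      split_ifs at hn with hl
      · rw [Z1_iff] at hn; grind
      · rw [Z2_iff] at hn; grind
    rcases hV S RQ gQ with h | h
    · have : f (mix A G RQ) = x := by
        refine hopA hSP H' G RQ gH' gG gQ (· = x) (by rw [hHV' RQ gQ]; exact h) ?_
        intro i hi u w hne hu _ hw ho hn
        simp only [hH', hG] at hne ho hn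
        split_ifs at hne ho hn with hl
        · exact absurd rfl hne
        · have := rgt_lt _ _ hl
          rw [RL_iff] at ho; rw [Z2_iff] at hn; grind
      linarith
    · have : f (mix A G RQ) = y := by
        refine hopA hSP H G RQ gH gG gQ (· = y) (by rw [hHV RQ gQ]; exact h) ?_
        intro i hi u w hne hu _ hw ho hn
        simp only [hH, hG] at hne ho hn
        split_ifs at hne ho hn with hl
        · have := lft_lt _ _ hl
          rw [LL_iff] at ho; rw [Z1_iff] at hn; grind
        · exact absurd rfl hne
      linarith
  · -- pivot
    have hnone' : ∀ d, GoodD A d → f (mix A (a (insert k S)) d) = y := fun d hd =>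
      (hV _ d hd).resolve_left (hnone ⟨d, hd⟩)
    have hall' : ∀ d, GoodD A d → f (mix A (a S) d) = x := fun d hd => hall ⟨d, hd⟩
    have lft_ne : ∀ i, i ≠ k → (lft (insert k S) i ↔ lft S i) := by
      intro i hi; simp [hlft, hi]
    have hk : k ∈ A ∧ x < p k ∧ p k < y := by
      by_contra hc
      have : mix A (a S) Rx = mix A (a (insert k S)) Rx := by
        funext i
        by_cases hi : i ∈ A
        · simp only [mix, hi, if_true, ha]
          by_cases hik : i = k
          · subst hik
            have : lft (insert i S) i ↔ lft S i := by simp only [hlft]; simp; grind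
            simp only [this]
          · simp only [lft_ne i hik]
        · simp [mix, hi]
      have h1 := hall' Rx (adm_goodD admx)
      rw [this, hnone' Rx (adm_goodD admx)] at h1
      linarith
    obtain ⟨hkA, hxk, hky⟩ := hk
    have hkl : lft S k := Or.inr ⟨hky, hkS⟩
    have hkr : ¬ lft (insert k S) k := by simp [hlft, hxk]
    obtain ⟨RQ, admQ, fQ⟩ := hp k hkA
    have hkΩ := hp k hkA
    have hkX := hΩ hkΩ
    have hxX := hΩ hxΩ
    have gQ := adm_goodD admQ
    set cl : N → Pref X := fun i => if i = k then LL X (p k) else if lft S i then RL X x else Z2 X y (p k) with hcl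
    set cr : N → Pref X := fun i => if i = k then RL X (p k) else if lft S i then RL X x else Z2 X y (p k) with hcr
    set c' : N → Pref X := fun i => if i = k then RL X (p k) else if lft S i then RL X x else RL X (p i) with hc'
    set e : N → Pref X := fun i => if i = k then RL X (p k) else if lft S i then Z1 X x (p k) else Z2 X y (p k) with he
    have gcl : GoodA A cl := by
      intro i hi; simp only [hcl]; split_ifs
      · exact LL_sp hkX
      · exact RL_sp hxX
      · exact Z2_sp hkX hky
    have gcr : GoodA A cr := by
      intro i hi; simp only [hcr]; split_ifs
      · exact RL_sp hkX
      · exact RL_sp hxX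
      · exact Z2_sp hkX hky
    have gc' : GoodA A c' := by
      intro i hi; simp only [hc']; split_ifs
      · exact RL_sp hkX
      · exact RL_sp hxX
      · exact RL_sp (hΩ (hp i hi))
    have ge : GoodA A e := by
      intro i hi; simp only [he]; split_ifs
      · exact RL_sp hkX
      · exact Z1_sp hkX hxk
      · exact Z2_sp hkX hky
    have v1 : f (mix A cl RQ) = x := by
      refine hopA hSP _ _ RQ (ga S) gcl gQ (· = x) (hall' RQ gQ) ?_
      intro i hi u w hne hu _ hw ho hn
      simp only [ha, hcl] at hne ho hn
      by_cases hik : i = k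
      · subst hik; simp [hkl] at hne
      simp only [hik, if_false] at hne ho hn
      by_cases hl : lft S i
      · simp only [hl, if_true] at ho hn
        rw [RL_iff] at hn; grind
      · have := rgt_lt _ _ hl
        simp only [hl, if_false] at ho hn
        rw [RL_iff] at ho; rw [Z2_iff] at hn; grind
    have v2 : f (mix A c' RQ) = y := by
      refine hopA hSP _ _ RQ (ga (insert k S)) gc' gQ (· = y) (hnone' RQ gQ) ?_
      intro i hi u w hne hu _ hw ho hn
      simp only [ha, hc'] at hne ho hn
      by_cases hik : i = k
      · subst hik; simp [hkr] at hne
      simp only [hik, if_false, lft_ne i hik] at hne ho hn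
      by_cases hl : lft S i
      · have := lft_lt _ _ hl
        simp only [hl, if_true] at ho hn
        rw [LL_iff] at ho; rw [RL_iff] at hn; grind
      · simp [hl] at hne
    have v3 : p k ≤ f (mix A cr RQ) ∧ f (mix A cr RQ) ≤ y := by
      refine hopA hSP _ _ RQ gc' gcr gQ (fun t => p k ≤ t ∧ t ≤ y) (by rw [v2]; exact ⟨hky.le, le_rfl⟩) ?_
      intro i hi u w hne hu _ hw ho hn
      simp only [hcr, hc'] at hne ho hn
      by_cases hik : i = k
      · subst hik; simp at hne
      simp only [hik, if_false] at hne ho hn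
      by_cases hl : lft S i
      · simp [hl] at hne
      · simp only [hl, if_false] at ho hn
        rw [Z2_iff] at hn; grind
    have v4 : f (mix A e RQ) = p k := by
      refine hopA hSP RQ e RQ (adm_goodA admQ) ge gQ (· = p k) (by rw [mix_self]; exact fQ) ?_
      intro i hi u w hne hu _ hw ho hn
      simp only [he] at hn
      split_ifs at hn with hik hl
      · rw [RL_iff] at hn; grind
      · rw [Z1_iff] at hn; grind
      · rw [Z2_iff] at hn; grind
    have v5 : x ≤ f (mix A cr RQ) ∧ f (mix A cr RQ) ≤ p k := by
      refine hopA hSP _ _ RQ ge gcr gQ (fun t => x ≤ t ∧ t ≤ p k) (by rw [v4]; exact ⟨hxk.le, le_rfl⟩) ?_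
      intro i hi u w hne hu _ hw ho hn
      simp only [hcr, he] at hne ho hn
      by_cases hik : i = k
      · subst hik; simp at hne
      simp only [hik, if_false] at hne ho hn
      by_cases hl : lft S i
      · simp only [hl, if_true] at ho hn
        rw [RL_iff] at hn; grind
      · simp [hl] at hne
    have v6 : f (mix A cr RQ) ≠ p k := by
      refine hopA hSP _ _ RQ gcl gcr gQ (fun t => t ≠ p k) (by rw [v1]; exact hxk.ne) ?_
      intro i hi u w hne hu _ hw ho hn hwk
      simp only [hcl, hcr] at hne ho hn
      by_cases hik : i = k
      · subst hik
        simp only [if_true] at ho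
        apply ho
        rw [LL_iff, hwk]
        left
        exact ⟨le_rfl, (lt_or_gt_of_ne hu).symm⟩
      · simp [hik] at hne
    exact v6 (le_antisymm v5.2 v3.1)

end caseThree

section caseOne
variable {N : Type} [Fintype N] [DecidableEq N] {X : Set ℝ} {A : Set N} {f : (N → Pref X) → ℝ}

lemma fixA {Ω : Set ℝ} {o u v c : ℝ} (hoX : o ∉ X) (huv : u ≠ v) (hou : o ≠ u) (hov : o ≠ v)
    (hvΩ : v ∈ Ω) (R : Pref X) (hR : SinglePeaked R) (hc : IsBest Ω R c) (hcu : c ≠ u) (hcv : c ≠ v) :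
    ∃ R' : Pref X, SinglePeaked R' ∧ IsBest Ω R' c ∧ (∀ b ∈ Ω, b ≠ c → b ≠ o → R'.pref o b) ∧
      (R'.pref u v ∨ R.pref v u) := by
  have step1 : ∃ R1 : Pref X, SinglePeaked R1 ∧ IsBest Ω R1 c ∧ (R1.pref u v ∨ R.pref v u) := by
    by_cases hu : u ∈ X
    · by_cases hv : v ∈ X
      · exact ⟨R, hR, hc, R.total u hu v hv huv⟩
      · refine ⟨pBot v R hv, (agree_bot _ _ _).sp hR, ⟨hc.1, fun b hb hbc => ⟨hcv, Or.inr (hc.2 b hb hbc)⟩⟩,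
          Or.inl ⟨huv, Or.inl rfl⟩⟩
    · refine ⟨pBelow u c R hu hcu, (agree_below _ _ _ _ _).sp hR, ⟨hc.1, fun b hb hbc => ?_⟩, Or.inl ?_⟩
      · have := hc.2 b hb hbc
        simp only [pBelow]
        by_cases hbu : b = u <;> tauto
      · have := hc.2 v hvΩ hcv.symm
        simp only [pBelow]
        have := huv.symm
        tauto
  obtain ⟨R1, h1, h2, h3⟩ := step1
  by_cases hco : c = o
  · subst hco
    exact ⟨R1, h1, h2, fun b hb hbc _ => h2.2 b hb hbc, h3⟩
  · refine ⟨pBelow o c R1 hoX hco, (agree_below _ _ _ _ _).sp h1, ⟨h2.1, fun b hb hbc => ?_⟩,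
      fun b hb hbc hbo => ?_, ?_⟩
    · have := h2.2 b hb hbc
      simp only [pBelow]
      by_cases hbu : b = o <;> tauto
    · have := h2.2 b hb hbc
      simp only [pBelow]
      tauto
    · simp only [pBelow]
      have := hou.symm
      have := hov.symm
      tauto

lemma fixD {o u v : ℝ} (hoX : o ∉ X) (huv : u ≠ v) (hou : o ≠ u) (hov : o ≠ v)
    (R : Pref X) (hR : SingleDipped R) :
    ∃ R' : Pref X, SingleDipped R' ∧ (∀ b, b ≠ o → R'.pref o b) ∧
      (R'.pref u v ∨ R.pref v u) := by
  have step1 : ∃ R1 : Pref X, SingleDipped R1 ∧ (R1.pref u v ∨ R.pref v u) := by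
    by_cases hu : u ∈ X
    · by_cases hv : v ∈ X
      · exact ⟨R, hR, R.total u hu v hv huv⟩
      · exact ⟨pBot v R hv, (agree_bot _ _ _).sd hR, Or.inl ⟨huv, Or.inl rfl⟩⟩
    · exact ⟨pTop u R hu, (agree_top _ _ _).sd hR, Or.inl ⟨huv.symm, Or.inl rfl⟩⟩
  obtain ⟨R1, h1, h3⟩ := step1
  refine ⟨pTop o R1 hoX, (agree_top _ _ _).sd h1, fun b hb => ⟨hb, Or.inl rfl⟩, ?_⟩
  simp only [pTop]
  have := hov.symm
  tauto

lemma stageOne (hSP : StrategyProof X A f) (p : N → ℝ) (hp : ∀ i ∈ A, p i ∈ SCRange X A f)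
    (u v : ℝ) (huv : u ≠ v)
    (hpk : ∀ R, Admissible X A R → (∀ i ∈ A, IsBest (SCRange X A f) (R i) (p i)) → f R = u ∨ f R = v)
    (hv : v ∈ SCRange X A f) (hu : u ∈ SCRange X A f)
    (o : ℝ) (hoX : o ∉ X) (hou : o ≠ u) (hov : o ≠ v)
    (PC : ℝ → Pref X) (hPC : ∀ c, c ≠ o → SinglePeaked (PC c) ∧ (∀ b, b ≠ c → (PC c).pref c b) ∧
      ∀ b, b ≠ c → b ≠ o → (PC c).pref o b)
    (R : N → Pref X) (adm : Admissible X A R) (pkR : ∀ i ∈ A, IsBest (SCRange X A f) (R i) (p i))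
    (fR : f R = u) :
    ∃ R' : N → Pref X, Admissible X A R' ∧ f R' = u ∧
      (∀ i ∈ A, p i = u ∨ p i = v → R' i = PC (p i)) ∧
      (∀ i ∈ A, ∀ b ∈ SCRange X A f, b ≠ p i → b ≠ o → (R' i).pref o b) ∧
      (∀ i, i ∉ A → ∀ b, b ≠ o → (R' i).pref o b) := by
  classical
  have ex : ∀ i, ∃ Q : Pref X,
      (i ∈ A → SinglePeaked Q ∧ IsBest (SCRange X A f) Q (p i) ∧ (p i = u ∨ p i = v → Q = PC (p i)) ∧
        (∀ b ∈ SCRange X A f, b ≠ p i → b ≠ o → Q.pref o b)) ∧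
      (i ∉ A → SingleDipped Q ∧ ∀ b, b ≠ o → Q.pref o b) ∧ (Q.pref u v ∨ (R i).pref v u) := by
    intro i
    by_cases hi : i ∈ A
    · by_cases hc : p i = u ∨ p i = v
      · have hpo : p i ≠ o := by rcases hc with h | h <;> rw [h] <;> [exact hou.symm; exact hov.symm]
        obtain ⟨h1, h2, h3⟩ := hPC (p i) hpo
        refine ⟨PC (p i), fun _ => ⟨h1, ⟨hp i hi, fun b _ hb => h2 b hb⟩, fun _ => rfl, fun b _ hb hb' => h3 b hb hb'⟩,
          fun h => absurd hi h, ?_⟩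
        rcases hc with h | h
        · left; rw [h] at h2 ⊢; exact h2 v huv.symm
        · right; have := (pkR i hi).2 u hu (by rw [h]; exact huv); rwa [h] at this
      · push Not at hc
        obtain ⟨Q, h1, h2, h3, h4⟩ := fixA hoX huv hou hov hv (R i) ((adm i).1 hi) (pkR i hi) hc.1 hc.2
        exact ⟨Q, fun _ => ⟨h1, h2, fun h => absurd h (by tauto), h3⟩, fun h => absurd hi h, h4⟩
    · obtain ⟨Q, h1, h2, h3⟩ := fixD hoX huv hou hov (R i) ((adm i).2 hi)
      exact ⟨Q, fun h => absurd h hi, fun _ => ⟨h1, h2⟩, h3⟩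
  choose R' h1 h2 h3 using ex
  have adm' : Admissible X A R' := fun i => ⟨fun hi => (h1 i hi).1, fun hi => (h2 i hi).1⟩
  refine ⟨R', adm', ?_, fun i hi => (h1 i hi).2.2.1, fun i hi => (h1 i hi).2.2.2, fun i hi => (h2 i hi).2⟩
  refine hop hSP R R' adm adm' (fun t => t = u ∨ t = v) (· = u) ?_ fR ?_
  · intro M hM hMi
    refine hpk M hM fun i hi => ?_
    rcases hMi i with h | h <;> rw [h]
    · exact pkR i hi
    · exact (h1 i hi).2.1
  · intro i s w hne hs _ hw ho hn
    rcases hw with hw | hw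
    · exact hw
    subst hw
    have hs' : s = u := hs
    subst hs'
    have := h3 i
    tauto

lemma caseOne (hSP : StrategyProof X A f) (p : N → ℝ) (hp : ∀ i ∈ A, p i ∈ SCRange X A f)
    (x y : ℝ) (hxy : x ≠ y) (hXne : X.Nonempty)
    (hpk : ∀ R, Admissible X A R → (∀ i ∈ A, IsBest (SCRange X A f) (R i) (p i)) → f R = x ∨ f R = y)
    (hxa : ∃ R, Admissible X A R ∧ (∀ i ∈ A, IsBest (SCRange X A f) (R i) (p i)) ∧ f R = x)
    (hya : ∃ R, Admissible X A R ∧ (∀ i ∈ A, IsBest (SCRange X A f) (R i) (p i)) ∧ f R = y)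
    (o : ℝ) (ho : o ∈ SCRange X A f) (hoX : o ∉ X) (hox : o ≠ x) (hoy : o ≠ y) : False := by
  classical
  obtain ⟨Rx, admx, pkx, fx⟩ := hxa
  obtain ⟨Ry, admy, pky, fy⟩ := hya
  have hxΩ : x ∈ SCRange X A f := ⟨Rx, admx, fx⟩
  have hyΩ : y ∈ SCRange X A f := ⟨Ry, admy, fy⟩
  have exPC : ∀ c, ∃ P : Pref X, c ≠ o → SinglePeaked P ∧ (∀ b, b ≠ c → P.pref c b) ∧
      ∀ b, b ≠ c → b ≠ o → P.pref o b := by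
    intro c
    obtain ⟨P, h1, h2⟩ := exists_pk hXne c
    by_cases hc : c = o
    · exact ⟨P, fun h => absurd hc h⟩
    refine ⟨pBelow o c P hoX hc, fun _ => ⟨(agree_below _ _ _ _ _).sp h1, fun b hb => ?_, fun b hb hbo => ?_⟩⟩
    · have := h2 b hb
      simp only [pBelow]
      by_cases hbu : b = o <;> tauto
    · have := h2 b hb
      simp only [pBelow]
      tauto
  choose PC hPC using exPC
  have exOT : ∀ c, ∃ P : Pref X, SinglePeaked P ∧ (∀ b, b ≠ o → P.pref o b) ∧
      ∀ b, b ≠ c → b ≠ o → P.pref c b := by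
    intro c
    obtain ⟨P, h1, h2⟩ := exists_pk hXne c
    exact ⟨pTop o P hoX, (agree_top _ _ _).sp h1, fun b hb => ⟨hb, Or.inl rfl⟩,
      fun b hb hbo => ⟨hbo, Or.inr (h2 b hb)⟩⟩
  choose OT hOT1 hOT2 hOT3 using exOT
  obtain ⟨Rx1, ax1, fx1, x1, x2, x3⟩ := stageOne hSP p hp x y hxy hpk hyΩ hxΩ o hoX hox hoy PC hPC Rx admx pkx fx
  obtain ⟨Ry1, ay1, fy1, y1, y2, y3⟩ := stageOne hSP p hp y x hxy.symm (fun R h1 h2 => (hpk R h1 h2).symm)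
    hxΩ hyΩ o hoX hoy hox PC hPC Ry admy pky fy
  set Rx2 : N → Pref X := fun i => if i ∈ A ∧ p i ≠ x then OT x else Rx1 i with hRx2
  have ax2 : Admissible X A Rx2 := by
    intro i; simp only [hRx2]; split_ifs with h
    · exact ⟨fun _ => hOT1 x, fun h' => absurd h.1 h'⟩
    · exact ax1 i
  have fx2 : f Rx2 = x := by
    refine hopΩ hSP Rx1 Rx2 ax1 ax2 (· = x) fx1 ?_
    intro i s w hne hs _ hw h1 h2
    have hs' : s = x := hs
    subst hs'
    simp only [hRx2] at hne h2
    split_ifs at hne h2 with h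
    · by_contra hwx
      have hwo : w = o := by
        by_contra hwo
        exact h2 (hOT3 _ w hwx hwo)
      subst hwo
      exact h1 (x2 i h.1 s hxΩ h.2.symm hox.symm)
    · exact absurd rfl hne
  set Ry2 : N → Pref X := fun i => if i ∈ A ∧ p i ≠ x ∧ p i ≠ y then OT y else Ry1 i with hRy2
  have ay2 : Admissible X A Ry2 := by
    intro i; simp only [hRy2]; split_ifs with h
    · exact ⟨fun _ => hOT1 y, fun h' => absurd h.1 h'⟩
    · exact ay1 i
  have fy2 : f Ry2 = y := by
    refine hopΩ hSP Ry1 Ry2 ay1 ay2 (· = y) fy1 ?_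
    intro i s w hne hs _ hw h1 h2
    have hs' : s = y := hs
    subst hs'
    simp only [hRy2] at hne h2
    split_ifs at hne h2 with h
    · by_contra hwx
      have hwo : w = o := by
        by_contra hwo
        exact h2 (hOT3 _ w hwx hwo)
      subst hwo
      exact h1 (y2 i h.1 s hyΩ h.2.2.symm hoy.symm)
    · exact absurd rfl hne
  set Ry3 : N → Pref X := fun i => if i ∈ A ∧ p i ≠ x then OT y else Ry1 i with hRy3
  have ay3 : Admissible X A Ry3 := by
    intro i; simp only [hRy3]; split_ifs with h
    · exact ⟨fun _ => hOT1 y, fun h' => absurd h.1 h'⟩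
    · exact ay1 i
  have fy3 : f Ry3 = y ∨ f Ry3 = o := by
    refine hopΩ hSP Ry2 Ry3 ay2 ay3 (fun t => t = y ∨ t = o) (Or.inl fy2) ?_
    intro i s w hne hs _ hw h1 h2
    by_contra hcon
    push Not at hcon
    by_cases h : i ∈ A ∧ p i ≠ x
    · simp only [hRy3] at h2
      rw [if_pos h] at h2
      rcases hs with rfl | rfl
      · exact h2 (hOT3 _ w hcon.1 hcon.2)
      · exact h2 (hOT2 _ w hcon.2)
    · apply hne
      simp only [hRy2, hRy3]
      rw [if_neg h, if_neg (by tauto)]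
  have fy3' : f Ry3 = y := by
    refine fy3.resolve_right fun hc => ?_
    have : f Rx2 = o := by
      refine hopΩ hSP Ry3 Rx2 ay3 ax2 (· = o) hc ?_
      intro i s w hne hs _ hw h1 h2
      have hs' : s = o := hs
      subst hs'
      by_contra hcon
      apply h2
      simp only [hRx2]
      split_ifs with h
      · exact hOT2 _ w hcon
      · by_cases hi : i ∈ A
        · exfalso
          have hpx : p i = x := by tauto
          apply hne
          simp only [hRx2, hRy3]
          rw [if_neg h, if_neg h, x1 i hi (Or.inl hpx), y1 i hi (Or.inr hpx)]
        · exact x3 i hi w hcon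
    rw [fx2] at this
    exact hox this.symm
  set Ry4 : N → Pref X := fun i => if i ∈ A then OT y else Ry1 i with hRy4
  have ay4 : Admissible X A Ry4 := by
    intro i; simp only [hRy4]; split_ifs with h
    · exact ⟨fun _ => hOT1 y, fun h' => absurd h h'⟩
    · exact ay1 i
  have fy4 : f Ry4 = y := by
    refine hopΩ hSP Ry3 Ry4 ay3 ay4 (· = y) fy3' ?_
    intro i s w hne hs _ hw h1 h2
    have hs' : s = y := hs
    subst hs'
    by_cases hi : i ∈ A
    swap
    · simp [hRy3, hRy4, hi] at hne
    by_cases hpx : p i = x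
    swap
    · simp [hRy3, hRy4, hi, hpx] at hne
    simp only [hRy3, hRy4, hi, hpx, true_and, ne_eq, not_true, if_false, if_true] at h1 h2
    by_contra hwx
    have hwo : w = o := by
      by_contra hwo
      exact h2 (hOT3 _ w hwx hwo)
    subst hwo
    exact h1 (y2 i hi s hyΩ (by rw [hpx]; exact hxy.symm) hoy.symm)
  obtain ⟨RO, admO, fO⟩ := ho
  have : f Ry4 = o := by
    refine hopΩ hSP RO Ry4 admO ay4 (· = o) fO ?_
    intro i s w hne hs _ hw h1 h2
    have hs' : s = o := hs
    subst hs'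
    by_contra hcon
    apply h2
    simp only [hRy4]
    split_ifs with h
    · exact hOT2 _ w hcon
    · exact y3 i h w hcon
  rw [fy4] at this
  exact hoy this.symm

end caseOne

section caseTwo
variable {N : Type} [Fintype N] [DecidableEq N] {X : Set ℝ} {A : Set N} {f : (N → Pref X) → ℝ}

lemma fixDip {o y w : ℝ} (hoX : o ∉ X) (hoy : o ≠ y) (hwX : w ∈ X) (hwo : w ≠ o) (hwy : w ≠ y)
    (B : Pref X) (hB : SingleDipped B) :
    ∃ B1 B2 : Pref X, SingleDipped B1 ∧ SingleDipped B2 ∧ (B1 = B ∨ B1.pref y o) ∧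
      (∀ t, t ≠ o → (t ∈ X ∨ t = y) → t ≠ w → B1 = B ∨ B.pref t w ∨ B1.pref w t) ∧
      (∀ t, (t ∈ X ∨ t = y ∨ t = o) → t ≠ w → B1 = B2 ∨ B1.pref t w ∨ B2.pref w t) ∧
      B2.pref o y := by
  have hyo := hoy.symm
  by_cases h1 : B.pref o y
  · exact ⟨B, B, hB, hB, Or.inl rfl, fun _ _ _ _ => Or.inl rfl, fun _ _ _ => Or.inl rfl, h1⟩
  by_cases h2 : B.pref y w
  · refine ⟨pAbove o w B hoX hwo, pTop o (pAbove o w B hoX hwo) hoX, (agree_above _ _ _ _ _).sd hB,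
      (agree_top _ _ _).sd ((agree_above _ _ _ _ _).sd hB), Or.inr ?_, ?_, ?_, ⟨hyo, Or.inl rfl⟩⟩
    · simp only [pAbove]; tauto
    · intro t hto ht htw
      right
      rcases ht with ht | rfl
      · have := B.total t ht w hwX htw
        simp only [pAbove]; tauto
      · exact Or.inl h2
    · intro t ht htw
      right
      rcases ht with ht | rfl | rfl
      · have := B.total t ht w hwX htw
        have hto : t ≠ o := by rintro rfl; exact hoX ht
        simp only [pAbove, pTop]; tauto
      · left; simp only [pAbove]; tauto
      · left; simp only [pAbove]; tauto
  · have : ∃ B' : Pref X, Agree B B' ∧ B'.pref w y := by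
      by_cases hy : y ∈ X
      · exact ⟨B, fun _ _ _ _ => Iff.rfl, (B.total y hy w hwX hwy.symm).resolve_left h2⟩
      · exact ⟨pBot y B hy, agree_bot _ _ _, hwy, Or.inl rfl⟩
    obtain ⟨B', hag, hwy'⟩ := this
    refine ⟨B, pBelow o w B' hoX hwo, hB, (agree_below _ _ _ _ _).sd (hag.sd hB), Or.inl rfl,
      fun _ _ _ _ => Or.inl rfl, ?_, ?_⟩
    · intro t ht htw
      right
      rcases ht with ht | rfl | rfl
      · have := B.total t ht w hwX htw
        have := hag w hwX t ht
        have hto : t ≠ o := by rintro rfl; exact hoX ht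
        simp only [pBelow]; tauto
      · right; simp only [pBelow]; tauto
      · right; simp only [pBelow]; tauto
    · simp only [pBelow]; tauto

lemma fixQ {o y z : ℝ} (hoX : o ∉ X) (hoy : o ≠ y) (hzX : z ∈ X) (hzo : z ≠ o) (hzy : z ≠ y)
    (B : Pref X) (hB : SingleDipped B) :
    ∃ B' : Pref X, SingleDipped B' ∧ B'.pref y o ∧
      (∀ t, (t ∈ X ∨ t = y ∨ t = o) → t ≠ z → B.pref t z ∨ B'.pref z t) := by
  have : ∃ B' : Pref X, Agree B B' ∧ (B.pref y z ∨ B'.pref z y) := by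
    by_cases hy : y ∈ X
    · exact ⟨B, fun _ _ _ _ => Iff.rfl, B.total y hy z hzX hzy.symm⟩
    · exact ⟨pBot y B hy, agree_bot _ _ _, Or.inr ⟨hzy, Or.inl rfl⟩⟩
  obtain ⟨B', hag, h⟩ := this
  refine ⟨pBot o B' hoX, (agree_bot _ _ _).sd (hag.sd hB), ⟨hoy.symm, Or.inl rfl⟩, fun t ht htz => ?_⟩
  rcases ht with ht | rfl | rfl
  · have := B.total t ht z hzX htz
    have := hag z hzX t ht
    simp only [pBot]; tauto
  · simp only [pBot]; tauto
  · simp only [pBot]; tauto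

set_option maxHeartbeats 1000000 in
lemma caseTwo (hSP : StrategyProof X A f) (p : N → ℝ) (hp : ∀ i ∈ A, p i ∈ SCRange X A f)
    (o y : ℝ) (hoy : o ≠ y) (hXne : X.Nonempty)
    (hpk : ∀ R, Admissible X A R → (∀ i ∈ A, IsBest (SCRange X A f) (R i) (p i)) → f R = o ∨ f R = y)
    (hoa : ∃ R, Admissible X A R ∧ (∀ i ∈ A, IsBest (SCRange X A f) (R i) (p i)) ∧ f R = o)
    (hya : ∃ R, Admissible X A R ∧ (∀ i ∈ A, IsBest (SCRange X A f) (R i) (p i)) ∧ f R = y)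
    (hoX : o ∉ X) (hoth : ∀ t ∈ SCRange X A f, t ≠ o → t ≠ y → t ∈ X)
    (z : ℝ) (hz : z ∈ SCRange X A f) (hzo : z ≠ o) (hzy : z ≠ y) : False := by
  classical
  obtain ⟨Ro, admo, pko, fo⟩ := hoa
  obtain ⟨Ry, admy, pky, fy⟩ := hya
  have hoΩ : o ∈ SCRange X A f := ⟨Ro, admo, fo⟩
  have hyΩ : y ∈ SCRange X A f := ⟨Ry, admy, fy⟩
  have hothΩ : ∀ t ∈ SCRange X A f, t ∈ X ∨ t = y ∨ t = o := by
    intro t ht; have := hoth t ht; tauto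
  choose pk hpk1 hpk2 using fun c => exists_pk hXne c
  have exOT : ∀ c, ∃ P : Pref X, SinglePeaked P ∧ (∀ b, b ≠ o → P.pref o b) ∧
      ∀ b, b ≠ c → b ≠ o → P.pref c b := by
    intro c
    exact ⟨pTop o (pk c) hoX, (agree_top _ _ _).sp (hpk1 c), fun b hb => ⟨hb, Or.inl rfl⟩,
      fun b hb hbo => ⟨hbo, Or.inr (hpk2 c b hb)⟩⟩
  choose OT hOT1 hOT2 hOT3 using exOT
  have exZB : ∀ c, ∃ P : Pref X, SinglePeaked P ∧ (∀ b, b ≠ o → P.pref b o) ∧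
      (c ≠ o → ∀ b, b ≠ c → P.pref c b) := by
    intro c
    exact ⟨pBot o (pk c) hoX, (agree_bot _ _ _).sp (hpk1 c), fun b hb => ⟨hb, Or.inl rfl⟩,
      fun hc b hb => ⟨hc, Or.inr (hpk2 c b hb)⟩⟩
  choose ZB hZB1 hZB2 hZB3 using exZB
  have exKY : ∀ i, ∃ P : Pref X, i ∈ A → p i ≠ o → SinglePeaked P ∧ IsBest (SCRange X A f) P (p i) ∧
      ∀ b, b ≠ o → P.pref b o := by
    intro i
    refine ⟨pBot o (Ro i) hoX, fun hi hio => ⟨(agree_bot _ _ _).sp ((admo i).1 hi),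
      ⟨hp i hi, fun b hb hbp => ⟨hio, Or.inr ((pko i hi).2 b hb hbp)⟩⟩, fun b hb => ⟨hb, Or.inl rfl⟩⟩⟩
  choose KY hKY using exKY
  have exKO : ∀ i, ∃ P : Pref X, i ∈ A → p i ≠ o → SinglePeaked P ∧ IsBest (SCRange X A f) P (p i) ∧
      ∀ b ∈ SCRange X A f, b ≠ p i → b ≠ o → P.pref o b := by
    intro i
    by_cases hio : p i = o
    · exact ⟨Ro i, fun _ h => absurd hio h⟩
    refine ⟨pBelow o (p i) (Ro i) hoX hio, fun hi _ => ⟨(agree_below _ _ _ _ _).sp ((admo i).1 hi),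
      ⟨hp i hi, fun b hb hbp => ?_⟩, fun b hb hbp hbo => ?_⟩⟩
    · have := (pko i hi).2 b hb hbp
      simp only [pBelow]
      by_cases hbu : b = o <;> tauto
    · have := (pko i hi).2 b hb hbp
      simp only [pBelow]
      tauto
  choose KO hKO using exKO
  set a : Finset N → N → Pref X := fun S i => if p i = o then OT y else if p i = y then ZB y else
    if i ∈ S then KY i else KO i with ha
  set lf : Finset N → N → Prop := fun S i => p i = o ∨ (p i ≠ y ∧ i ∉ S) with hlf
  have ga : ∀ S, GoodA A (a S) := by
    intro S i hi; simp only [ha]; split_ifs with h1 h2 h3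
    · exact hOT1 y
    · exact hZB1 y
    · exact (hKY i hi h1).1
    · exact (hKO i hi h1).1
  have best : ∀ S, ∀ i ∈ A, IsBest (SCRange X A f) (a S i) (p i) := by
    intro S i hi; simp only [ha]; split_ifs with h1 h2 h3
    · exact ⟨hp i hi, fun b _ hb => by rw [h1] at hb ⊢; exact hOT2 y b hb⟩
    · exact ⟨hp i hi, fun b _ hb => by rw [h2] at hb ⊢; exact hZB3 y hoy.symm b hb⟩
    · exact (hKY i hi h1).2.1
    · exact (hKO i hi h1).2.1
  have lf1 : ∀ S, ∀ i ∈ A, lf S i → ∀ b ∈ SCRange X A f, b ≠ p i → b ≠ o → (a S i).pref o b := by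
    intro S i hi hl b hb hbp hbo
    simp only [hlf] at hl
    simp only [ha]; split_ifs with h1 h2 h3
    · exact hOT2 y b hbo
    · tauto
    · tauto
    · exact (hKO i hi h1).2.2 b hb hbp hbo
  have lf2 : ∀ S, ∀ i ∈ A, ¬ lf S i → ∀ b, b ≠ o → (a S i).pref b o := by
    intro S i hi hl b hbo
    simp only [hlf] at hl
    simp only [ha]; split_ifs with h1 h2 h3
    · tauto
    · exact hZB2 y b hbo
    · exact (hKY i hi h1).2.2 b hbo
    · tauto
  have lf3 : ∀ S i, lf S i → p i ≠ y := by
    intro S i h; simp only [hlf] at h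
    rcases h with h | h
    · rw [h]; exact hoy
    · exact h.1
  have hV : ∀ S d, GoodD A d → f (mix A (a S) d) = o ∨ f (mix A (a S) d) = y := by
    intro S d hd
    refine hpk _ (adm_mix (ga S) hd) fun i hi => ?_
    simp only [mix, hi, if_true]
    exact best S i hi
  have e0 : f (mix A (a ∅) Ro) = o := by
    refine hop hSP Ro _ admo (adm_mix (ga ∅) (adm_goodD admo)) (fun t => t = o ∨ t = y) (· = o) ?_ fo ?_
    · intro M hM hMi
      refine hpk M hM fun i hi => ?_
      rcases hMi i with h | h <;> rw [h]
      · exact pko i hi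
      · simp only [mix, hi, if_true]; exact best _ i hi
    · intro i u w hne hu _ hw h1 h2
      rcases hw with hw | hw
      · exact hw
      exfalso
      by_cases hi : i ∈ A
      swap
      · simp [mix, hi] at hne
      simp only [mix, hi, if_true] at h2
      have hu' : u = o := hu
      subst hu'
      subst hw
      by_cases hiy : p i = w
      · have := (pko i hi).2 u hoΩ (by rw [hiy]; exact hoy)
        rw [hiy] at this
        exact h1 this
      · exact h2 (lf1 ∅ i hi (by simp [hlf, hiy]) w hyΩ (fun h => hiy h.symm) hoy.symm)
  have e1 : f (mix A (a Finset.univ) Ry) = y := by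
    refine hop hSP Ry _ admy (adm_mix (ga _) (adm_goodD admy)) (fun t => t = o ∨ t = y) (· = y) ?_ fy ?_
    · intro M hM hMi
      refine hpk M hM fun i hi => ?_
      rcases hMi i with h | h <;> rw [h]
      · exact pky i hi
      · simp only [mix, hi, if_true]; exact best _ i hi
    · intro i u w hne hu _ hw h1 h2
      rcases hw with hw | hw
      swap
      · exact hw
      exfalso
      by_cases hi : i ∈ A
      swap
      · simp [mix, hi] at hne
      simp only [mix, hi, if_true] at h2
      have hu' : u = y := hu
      subst hu'
      subst hw
      by_cases hiy : p i = w
      · have := (pky i hi).2 u hyΩ (by rw [hiy]; exact hoy.symm)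
        rw [hiy] at this
        exact h1 this
      · exact h2 (lf2 _ i hi (by simp [hlf, hiy]) u hoy.symm)
  -- the profiles where everybody wants `c`
  set cc : ℝ → (N → Prop) → Finset N → N → Pref X := fun c fz S i =>
    if fz i then a S i else if lf S i then OT c else ZB c with hcc
  have gcc : ∀ c fz S, GoodA A (cc c fz S) := by
    intro c fz S i hi; simp only [hcc]; split_ifs
    · exact ga S i hi
    · exact hOT1 c
    · exact hZB1 c
  have c_o : ∀ c fz S d, GoodD A d → f (mix A (a S) d) = o → f (mix A (cc c fz S) d) = o := by
    intro c fz S d hd h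
    refine hopA hSP _ _ d (ga S) (gcc c fz S) hd (· = o) h ?_
    intro i hi u w hne hu _ hw h1 h2
    have hu' : u = o := hu
    subst hu'
    by_contra hwo
    simp only [hcc] at hne h2
    split_ifs at hne h2 with g1 g2
    · exact hne rfl
    · exact h2 (hOT2 c w hwo)
    · exact h1 (lf2 S i hi g2 w hwo)
  have c_y : ∀ c fz S d, GoodD A d → f (mix A (a S) d) = y → f (mix A (cc c fz S) d) ≠ o := by
    intro c fz S d hd h
    set b : N → Pref X := fun i => if fz i then a S i else if lf S i then OT y else a S i with hb
    have gb : GoodA A b := by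
      intro i hi; simp only [hb]; split_ifs
      · exact ga S i hi
      · exact hOT1 y
      · exact ga S i hi
    have hby : f (mix A b d) = y := by
      refine hopA hSP _ _ d (ga S) gb hd (· = y) h ?_
      intro i hi u w hne hu _ hw h1 h2
      have hu' : u = y := hu
      subst hu'
      by_contra hwo
      simp only [hb] at hne h2
      split_ifs at hne h2 with g1 g2
      · exact hne rfl
      · have hwo' : w = o := by
          by_contra hc
          exact h2 (hOT3 u w hwo hc)
        subst hwo'
        exact h1 (lf1 S i hi g2 u hyΩ (lf3 S i g2).symm hoy.symm)
      · exact hne rfl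
    refine hopA hSP _ _ d gb (gcc c fz S) hd (· ≠ o) (by rw [hby]; exact hoy.symm) ?_
    intro i hi u w hne hu _ hw h1 h2 hwo
    subst hwo
    simp only [hb, hcc] at hne h1 h2
    split_ifs at hne h1 h2 with g1 g2
    · exact hne rfl
    · exact h1 (hOT2 y u hu)
    · exact h2 (hZB2 c u hu)
  set ee : ℝ → (N → Prop) → Finset N → N → Pref X := fun c fz S i =>
    if fz i then a S i else if lf S i then pk c else ZB c with hee
  have gee : ∀ c fz S, GoodA A (ee c fz S) := by
    intro c fz S i hi; simp only [hee]; split_ifs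
    · exact ga S i hi
    · exact hpk1 c
    · exact hZB1 c
  have c_z : ∀ c fz S d, GoodD A d → f (mix A (ee c fz S) d) = c →
      f (mix A (cc c fz S) d) = o ∨ f (mix A (cc c fz S) d) = c := by
    intro c fz S d hd h
    refine hopA hSP _ _ d (gee c fz S) (gcc c fz S) hd (fun t => t = o ∨ t = c) (Or.inr h) ?_
    intro i hi u w hne hu _ hw h1 h2
    by_contra hcon
    push Not at hcon
    simp only [hee, hcc] at hne h2
    split_ifs at hne h2 with g1 g2
    · exact hne rfl
    · rcases hu with rfl | rfl
      · exact h2 (hOT2 c w hcon.1)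
      · exact h2 (hOT3 _ w hcon.2 hcon.1)
    · exact hne rfl
  have e_best : ∀ c fz S, c ≠ o → (∀ i, fz i → i ∈ A → p i = c) → ∀ i ∈ A, ∀ b ∈ SCRange X A f, b ≠ c →
      (ee c fz S i).pref c b := by
    intro c fz S hco hfz i hi b hb hbc
    simp only [hee]; split_ifs with g1 g2
    · have := (best S i hi).2 b hb
      rw [hfz i g1 hi] at this
      exact this hbc
    · exact hpk2 c b hbc
    · exact hZB3 c hco b hbc
  rcases chain (δ := {d : N → Pref X // GoodD A d}) (fun S d => f (mix A (a S) d.1) = o)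
    ⟨⟨Ro, adm_goodD admo⟩, e0⟩ ⟨⟨Ry, adm_goodD admy⟩, by simp only [e1]; exact hoy.symm⟩ with
    ⟨S, ⟨⟨dO, gdo⟩, hdo⟩, ⟨⟨dy, gdy⟩, hdy⟩⟩ | ⟨S, k, hkS, hall, hnone⟩
  · replace hdy : f (mix A (a S) dy) = y := (hV S dy gdy).resolve_left hdy
    simp only at hdo
    have hzX := hoth z hz hzo hzy
    obtain ⟨RQ, admQ, fQ⟩ := hz
    set fz : N → Prop := fun _ => False with hfz
    set c := cc z fz S with hc
    have gc : GoodA A c := gcc z fz S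
    have D : ∀ d, GoodD A d → f (mix A c d) = f (mix A (a S) d) := by
      intro B gB
      rcases hV S B gB with h | h
      · rw [h]; exact c_o z fz S B gB h
      by_contra hcon
      rw [h] at hcon
      have hwo : f (mix A c B) ≠ o := c_y z fz S B gB h
      have hwX := hoth _ (mem_range (adm_mix gc gB)) hwo hcon
      generalize hw : f (mix A c B) = w at *
      have ex : ∀ i, ∃ B1 B2 : Pref X, i ∉ A → SingleDipped B1 ∧ SingleDipped B2 ∧ (B1 = B i ∨ B1.pref y o) ∧
          (∀ t, t ≠ o → (t ∈ X ∨ t = y) → t ≠ w → B1 = B i ∨ (B i).pref t w ∨ B1.pref w t) ∧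
          (∀ t, (t ∈ X ∨ t = y ∨ t = o) → t ≠ w → B1 = B2 ∨ B1.pref t w ∨ B2.pref w t) ∧
          B2.pref o y := by
        intro i
        by_cases hi : i ∈ A
        · exact ⟨B i, B i, fun h => absurd hi h⟩
        · obtain ⟨B1, B2, h⟩ := fixDip hoX hoy hwX hwo hcon (B i) (gB i hi)
          exact ⟨B1, B2, fun _ => h⟩
      choose d1 d2 hd using ex
      have gd1 : GoodD A d1 := fun i hi => (hd i hi).1
      have gd2 : GoodD A d2 := fun i hi => (hd i hi).2.1
      have s1 : ∀ e, GoodD A e → (∀ i, i ∉ A → e i = B i ∨ e i = d1 i) → f (mix A (a S) e) = y := by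
        intro e he hei
        refine hopD hSP (a S) B e (ga S) gB he (fun t => t = o ∨ t = y) (· = y)
          (fun e' he' _ => hV S e' he') h ?_
        intro i hi s w' hne hs _ hw' h1 h2
        rcases hw' with hw' | hw'
        swap
        · exact hw'
        exfalso
        have hs' : s = y := hs
        subst hs'
        subst hw'
        rcases hei i hi with h' | h'
        · exact hne h'.symm
        · rw [h'] at h2 hne
          rcases (hd i hi).2.2.1 with h'' | h''
          · exact hne h''.symm
          · exact h2 h''
      have s2 : f (mix A c d1) = w := by
        refine hopD hSP c B d1 gc gB gd1 (fun t => t ≠ o ∧ t ∈ SCRange X A f) (· = w)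
          (fun e he hei => ⟨c_y z fz S e he (s1 e he hei), mem_range (adm_mix gc he)⟩) hw ?_
        intro i hi s t hne hs _ ht h1 h2
        have hs' : s = w := hs
        subst hs'
        by_contra htw
        have h3 := (hd i hi).2.2.2.1 t ht.1 (by have := hothΩ t ht.2; tauto) htw
        rcases h3 with h3 | h3 | h3
        · exact hne h3.symm
        · exact h1 h3
        · exact h2 h3
      have s3 : f (mix A c d2) = w := by
        refine hopD hSP c d1 d2 gc gd1 gd2 (fun t => t ∈ SCRange X A f) (· = w)
          (fun e he hei => mem_range (adm_mix gc he)) s2 ?_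
        intro i hi s t hne hs _ ht h1 h2
        have hs' : s = w := hs
        subst hs'
        by_contra htw
        have h3 := (hd i hi).2.2.2.2.1 t (hothΩ t ht) htw
        rcases h3 with h3 | h3 | h3
        · exact hne h3
        · exact h1 h3
        · exact h2 h3
      have s4 : f (mix A (a S) d2) = o := by
        refine hopD hSP (a S) dO d2 (ga S) gdo gd2 (fun t => t = o ∨ t = y) (· = o)
          (fun e' he' _ => hV S e' he') hdo ?_
        intro i hi s t hne hs _ ht h1 h2
        rcases ht with ht | ht
        · exact ht
        exfalso
        have hs' : s = o := hs
        rw [hs', ht] at h2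
        exact h2 (hd i hi).2.2.2.2.2
      have s5 := c_o z fz S d2 gd2 s4
      exact hwo (s3.symm.trans s5)
    have ex : ∀ i, ∃ B' : Pref X, i ∉ A → SingleDipped B' ∧ B'.pref y o ∧
      (∀ t, (t ∈ X ∨ t = y ∨ t = o) → t ≠ z → (RQ i).pref t z ∨ B'.pref z t) := by
      intro i
      by_cases hi : i ∈ A
      · exact ⟨RQ i, fun h => absurd hi h⟩
      · obtain ⟨B', h⟩ := fixQ hoX hoy hzX hzo hzy (RQ i) ((admQ i).2 hi)
        exact ⟨B', fun _ => h⟩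
    choose Q' hQ' using ex
    have gQ' : GoodD A Q' := fun i hi => (hQ' i hi).1
    have t1 : f (mix A (ee z fz S) Q') = z := by
      refine hopΩ hSP RQ _ admQ (adm_mix (gee z fz S) gQ') (· = z) fQ ?_
      intro i s t hne hs _ ht h1 h2
      have hs' : s = z := hs
      subst hs'
      by_contra htz
      by_cases hi : i ∈ A
      · simp only [mix, hi, if_true] at h2
        exact h2 (e_best s fz S hzo (fun i h => h.elim) i hi t ht htz)
      · simp only [mix, hi, if_false] at h2
        have := (hQ' i hi).2.2 t (hothΩ t ht) htz
        tauto
    have t2 := c_z z fz S Q' gQ' t1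
    have t3 : f (mix A (a S) Q') = y := by
      refine hopD hSP (a S) dy Q' (ga S) gdy gQ' (fun t => t = o ∨ t = y) (· = y)
        (fun e' he' _ => hV S e' he') hdy ?_
      intro i hi s t hne hs _ ht h1 h2
      rcases ht with ht | ht
      swap
      · exact ht
      exfalso
      have hs' : s = y := hs
      rw [hs', ht] at h2
      exact h2 (hQ' i hi).2.1
    have t4 := D Q' gQ'
    rw [t3] at t4
    rcases t2 with t2 | t2
    · exact hoy (t2.symm.trans t4)
    · exact hzy (t2.symm.trans t4)
  · have hnone' : ∀ d, GoodD A d → f (mix A (a (insert k S)) d) = y := fun d hd =>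
      (hV _ d hd).resolve_left (hnone ⟨d, hd⟩)
    have hall' : ∀ d, GoodD A d → f (mix A (a S) d) = o := fun d hd => hall ⟨d, hd⟩
    have a_ne : ∀ i, i ≠ k → a (insert k S) i = a S i := by
      intro i hi; simp [ha, hi]
    have lf_ne : ∀ i, i ≠ k → (lf (insert k S) i ↔ lf S i) := by
      intro i hi; simp [hlf, hi]
    have hk : k ∈ A ∧ p k ≠ o ∧ p k ≠ y := by
      by_contra hc
      have : mix A (a S) Ro = mix A (a (insert k S)) Ro := by
        funext i
        by_cases hi : i ∈ A
        · simp only [mix, hi, if_true]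
          by_cases hik : i = k
          · subst hik
            simp only [ha]
            split_ifs with h1 h2 <;> first | rfl | tauto
          · rw [a_ne i hik]
        · simp [mix, hi]
      have h1 := hall' Ro (adm_goodD admo)
      rw [this, hnone' Ro (adm_goodD admo)] at h1
      exact hoy h1.symm
    obtain ⟨hkA, hko, hky⟩ := hk
    obtain ⟨RQ, admQ, fQ⟩ := hp k hkA
    have gQ := adm_goodD admQ
    set fz : N → Prop := fun i => i = k with hfz
    have t1 : f (mix A (ee (p k) fz (insert k S)) RQ) = p k := by
      refine hopA hSP RQ _ RQ (adm_goodA admQ) (gee _ fz _) gQ (· = p k) (by rw [mix_self]; exact fQ) ?_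
      intro i hi s t hne hs _ ht h1 h2
      have hs' : s = p k := hs
      rw [hs'] at h2
      by_contra htz
      exact h2 (e_best (p k) fz _ hko (fun i h _ => by rw [h]) i hi t ht htz)
    have t2 := (c_z _ fz _ RQ gQ t1).resolve_left (c_y _ fz _ RQ gQ (hnone' RQ gQ))
    have t3 := c_o (p k) fz S RQ gQ (hall' RQ gQ)
    have t4 : f (mix A (cc (p k) fz (insert k S)) RQ) ≠ p k := by
      refine hopA hSP _ _ RQ (gcc (p k) fz S) (gcc _ fz _) gQ (· ≠ p k) (by rw [t3]; exact hko.symm) ?_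
      intro i hi s t hne hs hsΩ ht h1 h2 htk
      by_cases hik : i = k
      · subst hik
        simp only [hcc, hfz, if_true] at h1
        rw [htk] at h1
        exact h1 ((best S i hi).2 s hsΩ hs)
      · apply hne
        simp only [hcc, hfz, hik, if_false, lf_ne i hik]
    exact t4 t2

end caseTwo

/-- first part of Proposition 2: a preselected pair consists of
contiguous alternatives of the range. -/
theorem stmt7 {N : Type} [Fintype N] [DecidableEq N] (X : Set ℝ) (hX : X.Countable)
    (A : Set N) (f : (N → Pref X) → ℝ) (hSP : StrategyProof X A f)
    (p : N → ℝ) (hp : ∀ i ∈ A, p i ∈ SCRange X A f)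
    (x y : ℝ) (hxy : x < y) (hO : OmegaPvec X A f p = {x, y}) :
    SCRange X A f ∩ Set.Ioo x y = ∅ := by
  classical
  have hpk : ∀ R, Admissible X A R → (∀ i ∈ A, IsBest (SCRange X A f) (R i) (p i)) → f R = x ∨ f R = y := by
    intro R h1 h2
    have : f R ∈ OmegaPvec X A f p := ⟨R, h1, h2, rfl⟩
    rw [hO] at this
    simpa using this
  have hxa : ∃ R, Admissible X A R ∧ (∀ i ∈ A, IsBest (SCRange X A f) (R i) (p i)) ∧ f R = x := by
    have : x ∈ OmegaPvec X A f p := by rw [hO]; simp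
    exact this
  have hya : ∃ R, Admissible X A R ∧ (∀ i ∈ A, IsBest (SCRange X A f) (R i) (p i)) ∧ f R = y := by
    have : y ∈ OmegaPvec X A f p := by rw [hO]; simp
    exact this
  have hXne : X.Nonempty := by
    obtain ⟨Rx, admx, _, fx⟩ := hxa
    obtain ⟨Ry, admy, _, fy⟩ := hya
    rcases isEmpty_or_nonempty N with hN | ⟨⟨i⟩⟩
    · have : Rx = Ry := Subsingleton.elim _ _
      rw [this] at fx
      exact absurd (fx.symm.trans fy) hxy.ne
    · by_cases hi : i ∈ A
      · obtain ⟨q, hq, _⟩ := (admx i).1 hi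
        exact ⟨q, hq⟩
      · obtain ⟨q, hq, _⟩ := (admx i).2 hi
        exact ⟨q, hq⟩
  rw [Set.eq_empty_iff_forall_notMem]
  rintro z ⟨hz, hxz, hzy⟩
  have hoth : ∀ t ∈ SCRange X A f, t ≠ x → t ≠ y → t ∈ X := by
    intro t ht htx hty
    by_contra htX
    exact caseOne hSP p hp x y hxy.ne hXne hpk hxa hya t ht htX htx hty
  by_cases hxX : x ∈ X
  · by_cases hyX : y ∈ X
    · refine caseThree hSP p hp x y hxy hpk hxa hya (fun t ht => ?_) z hz hxz hzy
      by_cases h1 : t = x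
      · rw [h1]; exact hxX
      by_cases h2 : t = y
      · rw [h2]; exact hyX
      exact hoth t ht h1 h2
    · exact caseTwo hSP p hp y x hxy.ne' hXne (fun R h1 h2 => (hpk R h1 h2).symm) hya hxa hyX
        (fun t ht h1 h2 => hoth t ht h2 h1) z hz hzy.ne hxz.ne'
  · exact caseTwo hSP p hp x y hxy.ne hXne hpk hxa hya hxX hoth z hz hxz.ne' hzy.ne
end

section
/- Every strategy-proof social choice rule on the mixed single-peaked/single-dipped domain is group strategy-proof: if no individual agent can profitably misreport, then no coalition S ⊆ N can misreport so that every member of S is strictly better off. -/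
namespace GSP

open Classical

/-- `T` and `T'` are equal off `S`. -/
def Agree {N : Type} {X : Set ℝ} (S : Set N) (T T' : N → Pref X) : Prop :=
  ∀ i, i ∉ S → T i = T' i

theorem irr {X : Set ℝ} (R : Pref X) (x : ℝ) : ¬ R.pref x x :=
  fun h => R.asymm x x h h

section rules

variable {N : Type} [Fintype N] {X : Set ℝ} {A : Set N} {f : (N → Pref X) → ℝ}

theorem sp_one [DecidableEq N] (hSP : StrategyProof X A f) {T T' : N → Pref X}
    (hT : Admissible X A T) (hT' : Admissible X A T') (i : N) (h : ∀ j, j ≠ i → T j = T' j) :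
    ¬ (T i).pref (f T') (f T) := by
  have e : Function.update T i (T' i) = T' := by
    funext j
    by_cases hj : j = i
    · subst hj; simp
    · simp [hj, h j hj]
  have := hSP T hT i (T' i) (by rw [e]; exact hT')
  rwa [e] at this

theorem adm_of {R R' T : N → Pref X} (hR : Admissible X A R) (hR' : Admissible X A R')
    (h : ∀ i, T i = R i ∨ T i = R' i) : Admissible X A T := by
  intro i
  rcases h i with h | h
  · rw [h]; exact hR i
  · rw [h]; exact hR' i

theorem path (Q : ℝ → Prop) {R R' : N → Pref X}
    (hR : Admissible X A R) (hR' : Admissible X A R') (h0 : Q (f R))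
    (step : ∀ i T T', R i ≠ R' i → Admissible X A T → Admissible X A T' → T i = R i → T' i = R' i →
      (∀ j, j ≠ i → T j = T' j) → Q (f T) → Q (f T')) : Q (f R') := by
  have key : ∀ F : Finset N, Q (f (fun j => if j ∈ F then R' j else R j)) := by
    intro F
    induction F using Finset.induction with
    | empty => simpa using h0
    | insert i F hi ih =>
      by_cases e : R i = R' i
      · have : (fun j => if j ∈ insert i F then R' j else R j)
            = (fun j => if j ∈ F then R' j else R j) := by
          funext j
          by_cases hj : j = i
          · subst hj; simp [hi, e]
          · simp [hj]
        rw [this]; exact ih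
      · refine step i _ _ e ?_ ?_ ?_ ?_ ?_ ih
        · apply adm_of hR hR'
          intro j; by_cases hj : j ∈ F <;> simp [hj]
        · apply adm_of hR hR'
          intro j; by_cases hj : j ∈ insert i F <;> simp only [hj, if_true, if_false] <;> simp
        · simp [hi]
        · simp
        · intro j hj; simp [hj]
  simpa using key Finset.univ

theorem mono [DecidableEq N] (hSP : StrategyProof X A f) {R R' : N → Pref X} {z : ℝ}
    (hR : Admissible X A R) (hR' : Admissible X A R') (h0 : f R = z)
    (h : ∀ i, R i = R' i ∨ ∀ w, w ≠ z → ¬ (R i).pref w z → (R' i).pref z w) : f R' = z := by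
  refine path (A := A) (f := f) (fun v => v = z) hR hR' h0 ?_
  intro i T T' hne hT hT' e e' hj hz
  have h1 := sp_one hSP hT hT' i hj
  have h2 := sp_one hSP hT' hT i (fun j hji => (hj j hji).symm)
  rw [e] at h1
  rw [e'] at h2
  by_contra hw
  rcases h i with h | h
  · exact hne h
  · rw [hz] at h1 h2
    exact h2 (h _ hw h1)

theorem common [DecidableEq N] (hSP : StrategyProof X A f) (P : Pref X)
    (hP : ∀ u v w, ¬ P.pref u v → ¬ P.pref v w → ¬ P.pref u w) {R R' : N → Pref X}
    (hR : Admissible X A R) (hR' : Admissible X A R')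
    (h : ∀ i, R i = R' i ∨ R i = P) : ¬ P.pref (f R') (f R) := by
  refine path (A := A) (f := f) (fun v => ¬ P.pref v (f R)) hR hR' (irr _ _) ?_
  intro i T T' hne hT hT' e e' hj hz
  have h1 := sp_one hSP hT hT' i hj
  have : T i = P := by
    rw [e]; exact (h i).resolve_left hne
  rw [this] at h1
  exact hP _ _ _ h1 hz

theorem chain [DecidableEq N] (hSP : StrategyProof X A f) (Ω : Set ℝ) (y : ℝ) (n : ℕ) :
    ∀ (S : Finset N), S.card = n → ∀ (R R' : N → Pref X),
    Admissible X A R → Admissible X A R' → Agree (S : Set N) R R' →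
    (∀ T, Admissible X A T → Agree (S : Set N) T R → f T ∈ Ω) →
    f R ≠ y →
    (∀ i ∈ S, (R i).pref y (f R)) →
    (∀ i ∈ S, ∀ v w, (R i).pref y w → ¬ (R i).pref v w → (R i).pref y v) →
    (∀ i ∈ S, ∀ j ∈ S, (∀ v ∈ Ω, (R i).pref y v → (R j).pref y v) ∨
      (∀ v ∈ Ω, (R j).pref y v → (R i).pref y v)) →
    f R' ≠ y := by
  induction n with
  | zero =>
    intro S hS R R' hR hR' hag _ hne _ _ _
    have : R = R' := by
      funext i
      apply hag
      rw [Finset.card_eq_zero.1 hS]; simp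
    rw [← this]; exact hne
  | succ n ih =>
    intro S hS R R' hR hR' hag hΩ hne hy hnt hch
    have hSne : S.Nonempty := by
      rw [← Finset.card_pos]; omega
    obtain ⟨i, hi, hmin⟩ := Finset.exists_minimalFor (fun i => {v | v ∈ Ω ∧ (R i).pref y v}) S hSne
    have hleast : ∀ j ∈ S, ∀ v ∈ Ω, (R i).pref y v → (R j).pref y v := by
      intro j hj
      rcases hch i hi j hj with h | h
      · exact h
      · have := hmin hj (fun v hv => ⟨hv.1, h v hv.1 hv.2⟩)
        intro v hv hp
        exact (this ⟨hv, hp⟩).2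
    set T : N → Pref X := Function.update R i (R' i) with hTdef
    have hT : Admissible X A T := by
      apply adm_of hR hR'
      intro j
      by_cases hj : j = i
      · subst hj; simp [T]
      · simp [T, hj]
    have hTR : ∀ j, j ≠ i → T j = R j := by
      intro j hj; simp [T, hj]
    have h1 := sp_one hSP hR hT i (fun j hj => (hTR j hj).symm)
    have h2 : (R i).pref y (f T) := hnt i hi _ _ (hy i hi) h1
    have hTΩ : f T ∈ Ω := by
      apply hΩ T hT
      intro j hj
      apply hTR
      rintro rfl
      exact hj (by simpa using hi)
    refine ih (S.erase i) (by rw [Finset.card_erase_of_mem hi, hS]; rfl) T R' hT hR' ?_ ?_ ?_ ?_ ?_ ?_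
    · intro j hj
      by_cases hji : j = i
      · subst hji; simp [T]
      · rw [hTR j hji]; apply hag
        intro hjS; apply hj; simp [hji]; simpa using hjS
    · intro T' hT' hag'
      apply hΩ T' hT'
      intro j hj
      have hji : j ≠ i := by
        rintro rfl; exact hj (by simpa using hi)
      rw [← hTR j hji]
      apply hag'
      intro h; exact hj (Finset.mem_of_mem_erase (Finset.mem_coe.1 h))
    · intro e; rw [e] at h2; exact irr _ _ h2
    · intro j hj
      rw [Finset.mem_erase] at hj
      rw [hTR j hj.1]
      exact hleast j hj.2 _ hTΩ h2
    · intro j hj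
      rw [Finset.mem_erase] at hj
      rw [hTR j hj.1]
      exact hnt j hj.2
    · intro j hj k hk
      rw [Finset.mem_erase] at hj hk
      rw [hTR j hj.1, hTR k hk.1]
      exact hch j hj.2 k hk.2

end rules

/-- Preference from a utility function. -/
def ofU {X : Set ℝ} (u : ℝ → ℕ ×ₗ ℝ) (hu : Set.InjOn u X) : Pref X where
  pref x y := u y < u x
  asymm x y h := not_lt_of_gt h
  trans x y z h h' := lt_trans h' h
  total x hx y hy hne := by
    rcases lt_trichotomy (u x) (u y) with h | h | h
    · exact Or.inr h
    · exact absurd (hu hx hy h) hne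
    · exact Or.inl h

theorem ofU_nt {X : Set ℝ} (u : ℝ → ℕ ×ₗ ℝ) (hu : Set.InjOn u X) (a b c : ℝ) :
    ¬ (ofU u hu).pref a b → ¬ (ofU u hu).pref b c → ¬ (ofU u hu).pref a c := by
  simp only [ofU, not_lt]
  intro h h'
  exact le_trans h h'

theorem lt_lex (a b : ℕ) (x y : ℝ) :
    (toLex (a, x) < toLex (b, y)) ↔ a < b ∨ a = b ∧ x < y := by
  rw [Prod.Lex.toLex_lt_toLex]

/-- left lovers with dip `c` -/
noncomputable def uL (X : Set ℝ) (c x : ℝ) : ℕ ×ₗ ℝ :=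
  if x ∈ X then (if x < c then toLex (2, -x) else toLex (1, x)) else toLex (0, 0)

/-- right lovers with dip `c` -/
noncomputable def uR (X : Set ℝ) (c x : ℝ) : ℕ ×ₗ ℝ :=
  if x ∈ X then (if c < x then toLex (2, x) else toLex (1, -x)) else toLex (0, 0)

/-- peak `c` -/
noncomputable def uP (c x : ℝ) : ℕ ×ₗ ℝ :=
  if c ≤ x then toLex (1, -x) else toLex (0, x)

theorem uL_inj (X : Set ℝ) (c : ℝ) : Set.InjOn (uL X c) X := by
  intro x hx y hy h
  simp only [uL, hx, hy, if_true] at h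
  split_ifs at h <;> simpa using h

theorem uR_inj (X : Set ℝ) (c : ℝ) : Set.InjOn (uR X c) X := by
  intro x hx y hy h
  simp only [uR, hx, hy, if_true] at h
  split_ifs at h <;> simpa using h

theorem uP_inj (X : Set ℝ) (c : ℝ) : Set.InjOn (uP c) X := by
  intro x hx y hy h
  simp only [uP] at h
  split_ifs at h <;> simpa using h

noncomputable def Lft (X : Set ℝ) (c : ℝ) : Pref X := ofU (uL X c) (uL_inj X c)
noncomputable def Rgt (X : Set ℝ) (c : ℝ) : Pref X := ofU (uR X c) (uR_inj X c)
noncomputable def Pk (X : Set ℝ) (c : ℝ) : Pref X := ofU (uP c) (uP_inj X c)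

theorem Lft_iff (X : Set ℝ) (c x y : ℝ) : (Lft X c).pref x y ↔
    x ∈ X ∧ (y ∉ X ∨ (x < c ∧ y < c ∧ x < y) ∨ (x < c ∧ c ≤ y) ∨ (c ≤ x ∧ c ≤ y ∧ y < x)) := by
  simp only [Lft, ofU, uL]
  by_cases hx : x ∈ X <;> by_cases hy : y ∈ X <;> by_cases h : x < c <;> by_cases h' : y < c <;>
    simp [hx, hy, h, h', lt_lex, not_le.2, not_lt.1]

theorem Rgt_iff (X : Set ℝ) (c x y : ℝ) : (Rgt X c).pref x y ↔
    x ∈ X ∧ (y ∉ X ∨ (c < x ∧ c < y ∧ y < x) ∨ (c < x ∧ y ≤ c) ∨ (x ≤ c ∧ y ≤ c ∧ x < y)) := by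
  simp only [Rgt, ofU, uR]
  by_cases hx : x ∈ X <;> by_cases hy : y ∈ X <;> by_cases h : c < x <;> by_cases h' : c < y <;>
    simp [hx, hy, h, h', lt_lex, not_le.2, not_lt.1]

theorem Pk_iff (X : Set ℝ) (c x y : ℝ) : (Pk X c).pref x y ↔
    ((c ≤ x ∧ c ≤ y ∧ x < y) ∨ (c ≤ x ∧ y < c) ∨ (x < c ∧ y < c ∧ y < x)) := by
  simp only [Pk, ofU, uP]
  by_cases h : c ≤ x <;> by_cases h' : c ≤ y <;>
    simp [h, h', lt_lex, not_le.1, not_lt.2]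

theorem Lft_dip {X : Set ℝ} {c : ℝ} (hc : c ∈ X) : SingleDipped (Lft X c) := by
  refine ⟨c, hc, ?_⟩
  intro x hx y hy h
  rw [Lft_iff]
  grind

theorem Rgt_dip {X : Set ℝ} {c : ℝ} (hc : c ∈ X) : SingleDipped (Rgt X c) := by
  refine ⟨c, hc, ?_⟩
  intro x hx y hy h
  rw [Rgt_iff]
  grind

/-- Lexicographic: first levels, then `R` on `X`. -/
def lexPref {X : Set ℝ} (l : ℝ → ℕ) (R : Pref X) : Pref X where
  pref x y := l y < l x ∨ (l x = l y ∧ x ∈ X ∧ y ∈ X ∧ R.pref x y)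
  asymm x y h h' := by
    have := R.asymm x y
    rcases h with h | h <;> rcases h' with h' | h'
    · omega
    · omega
    · omega
    · exact this h.2.2.2 h'.2.2.2
  trans x y z h h' := by
    rcases h with h | h <;> rcases h' with h' | h'
    · left; omega
    · left; omega
    · left; omega
    · right
      exact ⟨h.1.trans h'.1, h.2.1, h'.2.2.1, R.trans x y z h.2.2.2 h'.2.2.2⟩
  total x hx y hy hne := by
    rcases lt_trichotomy (l x) (l y) with h | h | h
    · right; left; exact h
    · rcases R.total x hx y hy hne with h' | h'
      · left; right; exact ⟨h, hx, hy, h'⟩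
      · right; right; exact ⟨h.symm, hy, hx, h'⟩
    · left; left; exact h

theorem lex_ext {X : Set ℝ} {l : ℝ → ℕ} {R : Pref X}
    (h : ∀ x ∈ X, ∀ y ∈ X, R.pref x y → l y ≤ l x) {x y : ℝ} (hx : x ∈ X) (hy : y ∈ X)
    (hxy : R.pref x y) : (lexPref l R).pref x y := by
  rcases (h x hx y hy hxy).lt_or_eq with h' | h'
  · exact Or.inl h'
  · exact Or.inr ⟨h'.symm, hx, hy, hxy⟩

theorem lex_dip {X : Set ℝ} {l : ℝ → ℕ} {R : Pref X}
    (h : ∀ x ∈ X, ∀ y ∈ X, R.pref x y → l y ≤ l x) (hR : SingleDipped R) :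
    SingleDipped (lexPref l R) := by
  obtain ⟨δ, hδ, H⟩ := hR
  exact ⟨δ, hδ, fun x hx y hy hxy => lex_ext h hy hx (H x hx y hy hxy)⟩

theorem lex_peak {X : Set ℝ} {l : ℝ → ℕ} {R : Pref X}
    (h : ∀ x ∈ X, ∀ y ∈ X, R.pref x y → l y ≤ l x) (hR : SinglePeaked R) :
    SinglePeaked (lexPref l R) := by
  obtain ⟨δ, hδ, H⟩ := hR
  exact ⟨δ, hδ, fun x hx y hy hxy => lex_ext h hx hy (H x hx y hy hxy)⟩

/-! ### at most two attainable alternatives for dipped coalitions -/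

noncomputable def mk {N : Type} {X : Set ℝ} (S I : Set N) (R : N → Pref X) (p q : Pref X) :
    N → Pref X := fun i => if i ∈ S then (if i ∈ I then p else q) else R i

theorem mk_adm {N : Type} {X : Set ℝ} {A S : Set N} (I : Set N) {R : N → Pref X}
    (hR : Admissible X A R) (hS : ∀ i ∈ S, i ∉ A) {p q : Pref X} (hp : SingleDipped p)
    (hq : SingleDipped q) : Admissible X A (mk S I R p q) := by
  intro i
  by_cases hi : i ∈ S
  · refine ⟨fun h => absurd h (hS i hi), fun _ => ?_⟩
    by_cases hI : i ∈ I <;> simp [mk, hi, hI, hp, hq]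
  · simpa [mk, hi] using hR i

theorem three {N : Type} [Fintype N] [DecidableEq N] {X : Set ℝ} {A : Set N}
    {f : (N → Pref X) → ℝ} (hSP : StrategyProof X A f) (S : Set N) (hS : ∀ i ∈ S, i ∉ A)
    {a y b : ℝ} (ha : a ∈ X) (hy : y ∈ X) (hb : b ∈ X) (hay : a < y) (hyb : y < b)
    {Ta R Tb : N → Pref X} (hTa : Admissible X A Ta) (hR : Admissible X A R)
    (hTb : Admissible X A Tb) (haga : Agree S Ta R) (hagb : Agree S Tb R)
    (fa : f Ta = a) (fy : f R = y) (fb : f Tb = b) : False := by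
  set I : Set N := {i | ∀ x ∈ X, x < y → (R i).pref x y} with hI
  have hJ : ∀ i ∈ S, i ∉ I → ∀ x ∈ X, y < x → (R i).pref x y := by
    intro i hi hiI x hx hyx
    obtain ⟨δ, hδ, H⟩ := (hR i).2 (hS i hi)
    by_cases h : y ≤ δ
    · exact absurd (fun x hx hxy => H y hy x hx (Or.inr ⟨hxy, h⟩)) hiI
    · exact H y hy x hx (Or.inl ⟨(not_le.1 h).le, hyx⟩)
  have aLR : Admissible X A (mk S I R (Lft X b) (Rgt X a)) :=
    mk_adm I hR hS (Lft_dip hb) (Rgt_dip ha)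
  have aRR : Admissible X A (mk S I R (Rgt X a) (Rgt X a)) :=
    mk_adm I hR hS (Rgt_dip ha) (Rgt_dip ha)
  have aLL : Admissible X A (mk S I R (Lft X b) (Lft X b)) :=
    mk_adm I hR hS (Lft_dip hb) (Lft_dip hb)
  have aKR : Admissible X A (mk S I R (Lft X y) (Rgt X a)) :=
    mk_adm I hR hS (Lft_dip hy) (Rgt_dip ha)
  have aLK : Admissible X A (mk S I R (Lft X b) (Rgt X y)) :=
    mk_adm I hR hS (Lft_dip hb) (Rgt_dip hy)
  have aKK : Admissible X A (mk S I R (Lft X y) (Rgt X y)) :=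
    mk_adm I hR hS (Lft_dip hy) (Rgt_dip hy)
  have e1 : f (mk S I R (Lft X b) (Rgt X a)) = y := by
    refine mono hSP hR aLR fy ?_
    intro i
    by_cases hi : i ∈ S
    · right
      intro w hw hn
      by_cases hiI : i ∈ I
      · simp only [mk, hi, hiI, if_true]
        rw [Lft_iff]
        have := hiI w
        grind
      · simp only [mk, hi, hiI, if_true, if_false]
        rw [Rgt_iff]
        have := hJ i hi hiI w
        grind
    · left; simp [mk, hi]
  have hcomm : ∀ {p q r s P : Pref X}, (∀ u v w, ¬ P.pref u v → ¬ P.pref v w → ¬ P.pref u w) →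
      Admissible X A (mk S I R p q) → Admissible X A (mk S I R r s) →
      (p = r ∨ p = P) → (q = s ∨ q = P) →
      ¬ P.pref (f (mk S I R r s)) (f (mk S I R p q)) := by
    intro p q r s P hP h1 h2 h3 h4
    refine common hSP P hP h1 h2 ?_
    intro i
    by_cases hi : i ∈ S <;> by_cases hiI : i ∈ I <;> simp [mk, hi, hiI, h3, h4]
  have nL : ∀ c, ∀ u v w, ¬ (Lft X c).pref u v → ¬ (Lft X c).pref v w → ¬ (Lft X c).pref u w :=
    fun c => ofU_nt _ _
  have nR : ∀ c, ∀ u v w, ¬ (Rgt X c).pref u v → ¬ (Rgt X c).pref v w → ¬ (Rgt X c).pref u w :=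
    fun c => ofU_nt _ _
  have e2 : ¬ (Rgt X a).pref b (f (mk S I R (Rgt X a) (Rgt X a))) := by
    rw [← fb]
    refine common hSP _ (nR a) aRR hTb ?_
    intro i
    by_cases hi : i ∈ S
    · right; simp [mk, hi]
    · left; simp [mk, hi, hagb i hi]
  have e3 : ¬ (Lft X b).pref a (f (mk S I R (Lft X b) (Lft X b))) := by
    rw [← fa]
    refine common hSP _ (nL b) aLL hTa ?_
    intro i
    by_cases hi : i ∈ S
    · right; simp [mk, hi]
    · left; simp [mk, hi, haga i hi]
  have e4 := hcomm (nL y) aKR aRR (Or.inr rfl) (Or.inl rfl)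
  have e4' := hcomm (nL b) aLR aKR (Or.inr rfl) (Or.inl rfl)
  have e5 := hcomm (nR y) aLK aLL (Or.inl rfl) (Or.inr rfl)
  have e5' := hcomm (nR a) aLR aLK (Or.inl rfl) (Or.inr rfl)
  have e6 := hcomm (nR y) aKK aKR (Or.inl rfl) (Or.inr rfl)
  have e6' := hcomm (nL y) aKK aLK (Or.inr rfl) (Or.inl rfl)
  rw [e1] at e4' e5'
  generalize f (mk S I R (Rgt X a) (Rgt X a)) = β at *
  generalize f (mk S I R (Lft X b) (Lft X b)) = α at *
  generalize f (mk S I R (Lft X y) (Rgt X a)) = w at *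
  generalize f (mk S I R (Lft X b) (Rgt X y)) = v at *
  generalize f (mk S I R (Lft X y) (Rgt X y)) = t at *
  clear hcomm nL nR
  rw [Rgt_iff] at e2 e5 e5' e6
  rw [Lft_iff] at e3 e4 e4' e6'
  have b2 : β ∈ X ∧ b ≤ β := by grind
  have b3 : α ∈ X ∧ α ≤ a := by grind
  have b4 : w ∈ X ∧ y < w := by grind
  have b5 : v ∈ X ∧ v < y := by grind
  have b6 : y < t := by grind
  have b7 : t < y := by grind
  exact absurd b6 (not_lt.2 b7.le)

/-- The case of a coalition of dipped agents. -/
theorem dipped {N : Type} [Fintype N] [DecidableEq N] {X : Set ℝ} {A : Set N}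
    {f : (N → Pref X) → ℝ} (hSP : StrategyProof X A f) (S : Set N) (hS : ∀ i ∈ S, i ∉ A)
    {y z : ℝ} (hy : y ∈ X) (hne : z ≠ y)
    {R R' : N → Pref X} (hR : Admissible X A R) (hR' : Admissible X A R')
    (hag : Agree S R R') (fz : f R = z) (fy : f R' = y)
    (hp : ∀ i ∈ S, (R i).pref y z) : False := by
  set Ω : Set ℝ := {v | ∃ T, Admissible X A T ∧ Agree S T R' ∧ f T = v} with hΩ
  have hside : (∀ v ∈ Ω, v ∈ X → y ≤ v) ∨ (∀ v ∈ Ω, v ∈ X → v ≤ y) := by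
    by_contra hcon
    push Not at hcon
    obtain ⟨⟨a, ⟨Ta, h1, h2, h3⟩, haX, hay⟩, ⟨b, ⟨Tb, h4, h5, h6⟩, hbX, hyb⟩⟩ := hcon
    exact three hSP S hS haX hy hbX hay hyb h1 hR' h4 h2 h5 h3 fy h6
  set l : N → ℝ → ℕ := fun i x =>
    if x ∈ X ∧ (R i).pref x z then 3 else if x = z then 2 else if x ∈ X then 1 else 0 with hl
  set R1 : N → Pref X := fun i => if i ∈ S then lexPref (l i) (R i) else R i with hR1
  have hmonl : ∀ i, ∀ x ∈ X, ∀ w ∈ X, (R i).pref x w → l i w ≤ l i x := by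
    intro i x hx w hw hxw
    have h1 := (R i).trans x w z hxw
    simp only [hl, hx, hw, true_and, if_true]
    by_cases h2 : (R i).pref w z
    · simp [h2, h1 h2]
    · by_cases h3 : w = z
      · subst h3; simp [hxw, h2]
      · simp only [h2, h3, if_false]
        split_ifs <;> omega
  have aR1 : Admissible X A R1 := by
    intro i
    by_cases hi : i ∈ S
    · refine ⟨fun h => absurd h (hS i hi), fun h => ?_⟩
      simp only [hR1, hi, if_true]
      exact lex_dip (hmonl i) ((hR i).2 h)
    · simpa [hR1, hi] using hR i
  have f1 : f R1 = z := by
    refine mono hSP hR aR1 fz ?_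
    intro i
    by_cases hi : i ∈ S
    · right
      intro w hw hn
      simp only [hR1, hi, if_true]
      left
      have := irr (R i) z
      simp only [hl, hw, hn, this, and_false, if_false, if_true]
      split_ifs <;> omega
    · left; simp [hR1, hi]
  have hyl : ∀ i ∈ S, l i y = 3 := by
    intro i hi; simp [hl, hy, hp i hi]
  have hylt : ∀ i ∈ S, ∀ v, (lexPref (l i) (R i)).pref y v ↔ v ∉ X ∨ (v ∈ X ∧ (R i).pref y v) := by
    intro i hi v
    simp only [lexPref, hyl i hi]
    by_cases hv : v ∈ X
    · have h1 := (R i).trans y z v (hp i hi)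
      have h2 := (R i).asymm v z
      by_cases hvz : (R i).pref v z
      · simp [hl, hv, hvz, hy]
      · by_cases hvz' : v = z
        · subst hvz'; simp [hl, hv, hvz, hp i hi]
        · have : (R i).pref z v ∨ z ∉ X := by
            by_cases hz : z ∈ X
            · exact Or.inl (((R i).total v hv z hz hvz').resolve_left hvz)
            · exact Or.inr hz
          have hyv : (R i).pref y v := by
            have hne' : v ≠ y := by
              rintro rfl; exact hvz (hp i hi)
            rcases (R i).total v hv y hy hne' with h | h
            · exact absurd ((R i).trans v y z h (hp i hi)) hvz
            · exact h
          simp [hl, hv, hvz, hvz', hyv]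
    · simp only [hl, hv, false_and, if_false]
      split_ifs <;> simp
  obtain ⟨F, hF⟩ : ∃ F : Finset N, (F : Set N) = S := ⟨S.toFinset, by simp⟩
  have hFm : ∀ i, i ∈ F → i ∈ S := by
    intro i hi; rw [← hF]; simpa using hi
  refine chain hSP Ω y F.card F rfl R1 R' aR1 hR' ?_ ?_ ?_ ?_ ?_ ?_ fy
  · rw [hF]; intro i hi; simp [hR1, hi, hag i hi]
  · rw [hF]; intro T hT hT'
    refine ⟨T, hT, ?_, rfl⟩
    intro i hi
    rw [hT' i hi]; simp [hR1, hi, hag i hi]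
  · rw [f1]; exact hne
  · intro i hi
    have hi := hFm i hi
    simp only [hR1, hi, if_true]
    rw [f1, hylt i hi]
    by_cases hz : z ∈ X
    · exact Or.inr ⟨hz, hp i hi⟩
    · exact Or.inl hz
  · intro i hi v w
    have hi := hFm i hi
    simp only [hR1, hi, if_true]
    intro h1 h2
    by_contra h3
    apply h2
    have h3' := h3
    rw [hylt i hi] at h3
    push Not at h3
    obtain ⟨hv, h3⟩ := h3
    by_cases hvy : v = y
    · rw [hvy]; exact h1
    · have := ((lexPref (l i) (R i)).total v hv y hy hvy).resolve_right h3'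
      exact (lexPref (l i) (R i)).trans _ _ _ this h1
  · intro i hi j hj
    have hi := hFm i hi
    have hj := hFm j hj
    simp only [hR1, hi, hj, if_true]
    by_contra hcon
    push Not at hcon
    obtain ⟨⟨x, hxΩ, hx1, hx2⟩, ⟨w, hwΩ, hw1, hw2⟩⟩ := hcon
    rw [hylt _ ‹_›] at hx1 hx2 hw1 hw2
    push Not at hx2 hw2
    have hx1 := (hx1.resolve_left (fun h => h hx2.1)).2
    have hw1 := (hw1.resolve_left (fun h => h hw2.1)).2
    obtain ⟨hxX, hx2⟩ := hx2
    obtain ⟨hwX, hw2⟩ := hw2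
    have hx2 := hx2 hxX
    have hw2 := hw2 hwX
    have hxy : x ≠ y := by rintro rfl; exact irr _ _ hx1
    have hwy : w ≠ y := by rintro rfl; exact irr _ _ hw1
    have hx3 := ((R j).total x hxX y hy hxy).resolve_right hx2
    have hw3 := ((R i).total w hwX y hy hwy).resolve_right hw2
    obtain ⟨δi, hδi, Hi⟩ := (hR i).2 (hS i hi)
    obtain ⟨δj, hδj, Hj⟩ := (hR j).2 (hS j hj)
    have ti1 := (R i).trans w y x hw3 hx1
    have tj1 := (R j).trans x y w hx3 hw1
    have ai1 := (R i).asymm _ _ hx1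
    have ai2 := (R i).asymm _ _ hw3
    have ai3 := (R i).asymm _ _ ti1
    have aj1 := (R j).asymm _ _ hw1
    have aj2 := (R j).asymm _ _ hx3
    have aj3 := (R j).asymm _ _ tj1
    have hxw : x ≠ w := by rintro rfl; exact irr _ _ ti1
    have i1 := Hi y hy x hxX
    have i2 := Hi x hxX y hy
    have i3 := Hi w hwX x hxX
    have i4 := Hi w hwX y hy
    have j1 := Hj y hy w hwX
    have j2 := Hj w hwX y hy
    have j3 := Hj x hxX w hwX
    have j4 := Hj x hxX y hy
    rcases hside with h | h
    · have h1 := lt_of_le_of_ne (h x hxΩ hxX) hxy.symm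
      have h2 := lt_of_le_of_ne (h w hwΩ hwX) hwy.symm
      rcases lt_or_gt_of_ne hxw with h3 | h3
      · grind
      · grind
    · have h1 := lt_of_le_of_ne (h x hxΩ hxX) hxy
      have h2 := lt_of_le_of_ne (h w hwΩ hwX) hwy
      rcases lt_or_gt_of_ne hxw with h3 | h3
      · grind
      · grind

theorem outside {N : Type} [Fintype N] [DecidableEq N] {X : Set ℝ} {A : Set N}
    {f : (N → Pref X) → ℝ} (hSP : StrategyProof X A f) (S : Set N)
    {y z : ℝ} (hy : y ∉ X) (hne : z ≠ y)
    {R R' : N → Pref X} (hR : Admissible X A R) (hR' : Admissible X A R')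
    (hag : Agree S R R') (fz : f R = z) (fy : f R' = y)
    (hp : ∀ i ∈ S, (R i).pref y z) : False := by
  set l : N → ℝ → ℕ := fun i x =>
    if x = y then 3 else if (R i).pref x z then 2 else if x = z then 1 else 0 with hl
  set R1 : N → Pref X := fun i => if i ∈ S then lexPref (l i) (R i) else R i with hR1
  have hmonl : ∀ i, ∀ x ∈ X, ∀ w ∈ X, (R i).pref x w → l i w ≤ l i x := by
    intro i x hx w hw hxw
    have h1 := (R i).trans x w z hxw
    have hxy : x ≠ y := by rintro rfl; exact hy hx
    have hwy : w ≠ y := by rintro rfl; exact hy hw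
    simp only [hl, hxy, hwy, if_false]
    by_cases h2 : (R i).pref w z
    · simp [h2, h1 h2]
    · by_cases h3 : w = z
      · subst h3; simp [hxw, h2]
      · simp [h2, h3]
  have aR1 : Admissible X A R1 := by
    intro i
    by_cases hi : i ∈ S
    · simp only [hR1, hi, if_true]
      exact ⟨fun h => lex_peak (hmonl i) ((hR i).1 h), fun h => lex_dip (hmonl i) ((hR i).2 h)⟩
    · simpa [hR1, hi] using hR i
  have f1 : f R1 = z := by
    refine mono hSP hR aR1 fz ?_
    intro i
    by_cases hi : i ∈ S
    · right
      intro w hw hn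
      simp only [hR1, hi, if_true]
      left
      have h1 := irr (R i) z
      have h2 : w ≠ y := by rintro rfl; exact hn (hp i hi)
      simp [hl, hw, hn, h1, h2, hne]
    · left; simp [hR1, hi]
  have f2 : f R1 = y := by
    refine mono hSP hR' aR1 fy ?_
    intro i
    by_cases hi : i ∈ S
    · right
      intro w hw hn
      simp only [hR1, hi, if_true]
      left
      simp only [hl, hw, if_false, if_true]
      split_ifs <;> omega
    · left; simp [hR1, hi, hag i hi]
  exact hne (f1.symm.trans f2)

theorem inside {N : Type} [Fintype N] [DecidableEq N] {X : Set ℝ} {A : Set N}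
    {f : (N → Pref X) → ℝ} (hSP : StrategyProof X A f) (S : Set N)
    {y z : ℝ} (hy : y ∈ X) (hne : z ≠ y)
    {R R' : N → Pref X} (hR : Admissible X A R) (hR' : Admissible X A R')
    (hag : Agree S R R') (fz : f R = z) (fy : f R' = y)
    (hp : ∀ i ∈ S, (R i).pref y z) : False := by
  set l : N → ℝ → ℕ := fun i x =>
    if x ∈ X ∧ (R i).pref x z then 2 else if x = z then 1 else 0 with hl
  set P : N → Pref X := fun i => lexPref (l i) (Pk X y) with hP
  have hyl : ∀ i ∈ S, l i y = 2 := by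
    intro i hi; simp [hl, hy, hp i hi]
  have htop : ∀ i ∈ S, ∀ w, w ≠ y → (P i).pref y w := by
    intro i hi w hw
    by_cases h : w ∈ X ∧ (R i).pref w z
    · right
      refine ⟨?_, hy, h.1, ?_⟩
      · rw [hyl i hi]; simp [hl, h]
      · rw [Pk_iff]; grind
    · left
      rw [hyl i hi]
      simp only [hl, h, if_false]
      split_ifs <;> omega
  have hpk : ∀ i ∈ S, i ∈ A → SinglePeaked (P i) := by
    intro i hi hiA
    obtain ⟨ρ, hρ, H⟩ := (hR i).1 hiA
    refine ⟨y, hy, ?_⟩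
    intro x hx w hw hxw
    have hb : (Pk X y).pref x w := by rw [Pk_iff]; grind
    have hmid : x = y ∨ (R i).pref x y ∨ (R i).pref x w := by
      have h1 := H x hx y hy
      have h2 := H x hx w hw
      grind
    have hle : l i w ≤ l i x := by
      have hyz := hp i hi
      have key : (R i).pref w z ∨ w = z → (R i).pref x z := by
        intro h
        rcases hmid with rfl | h' | h'
        · exact hyz
        · exact (R i).trans _ _ _ h' hyz
        · rcases h with h | rfl
          · exact (R i).trans _ _ _ h' h
          · exact h'
      simp only [hl, hx, hw, true_and]
      by_cases h : (R i).pref w z ∨ w = z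
      · simp only [key h, if_true]
        split_ifs <;> omega
      · push Not at h
        simp [h]
    rcases hle.lt_or_eq with h | h
    · exact Or.inl h
    · exact Or.inr ⟨h.symm, hx, hw, hb⟩
  have hadm : ∀ T : N → Pref X, Admissible X A T →
      Admissible X A (fun i => if i ∈ S ∧ i ∈ A then P i else T i) := by
    intro T hT i
    by_cases hi : i ∈ S ∧ i ∈ A
    · dsimp only; rw [if_pos hi]
      exact ⟨fun h => hpk i hi.1 h, fun h => absurd hi.2 h⟩
    · simpa only [hi, if_false] using hT i
  have f1 : f (fun i => if i ∈ S ∧ i ∈ A then P i else R i) = z := by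
    refine mono hSP hR (hadm R hR) fz ?_
    intro i
    by_cases hi : i ∈ S ∧ i ∈ A
    · right
      intro w hw hn
      simp only [hi, and_self, if_true]
      left
      have h1 := irr (R i) z
      simp [hl, hw, hn, h1]
    · left; simp only [hi, if_false]
  have f2 : f (fun i => if i ∈ S ∧ i ∈ A then P i else R' i) = y := by
    refine mono hSP hR' (hadm R' hR') fy ?_
    intro i
    by_cases hi : i ∈ S ∧ i ∈ A
    · right
      intro w hw hn
      simp only [hi, and_self, if_true]
      exact htop i hi.1 w hw
    · left; simp only [hi, if_false]
  refine dipped hSP (S \ A) (fun i hi => hi.2) hy hne (hadm R hR) (hadm R' hR') ?_ f1 f2 ?_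
  · intro i hi
    by_cases h : i ∈ S ∧ i ∈ A
    · simp only [h, and_self, if_true]
    · simp only [h, if_false]
      apply hag
      intro hS
      exact hi ⟨hS, fun hA => h ⟨hS, hA⟩⟩
  · intro i hi
    have h : ¬ (i ∈ S ∧ i ∈ A) := fun h => hi.2 h.2
    simp only [h, if_false]
    exact hp i hi.1

theorem main {N : Type} [Fintype N] [DecidableEq N] {X : Set ℝ} {A : Set N}
    {f : (N → Pref X) → ℝ} (hSP : StrategyProof X A f) : GroupStrategyProof X A f := by
  intro R hR S R' hR' ⟨⟨i0, hi0⟩, h⟩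
  have hag : GSP.Agree S R (fun j => if j ∈ S then R' j else R j) := by
    intro i hi; simp [hi]
  have hne : f R ≠ f (fun j => if j ∈ S then R' j else R j) := by
    intro e
    have := h i0 hi0
    rw [← e] at this
    exact GSP.irr _ _ this
  by_cases hy : f (fun j => if j ∈ S then R' j else R j) ∈ X
  · exact GSP.inside hSP S hy hne hR hR' hag rfl rfl h
  · exact GSP.outside hSP S hy hne hR hR' hag rfl rfl h

end GSP

/-- on the mixed single-peaked/single-dipped domain, every
strategy-proof rule is group strategy-proof. -/
theorem stmt14 {N : Type} [Fintype N] [DecidableEq N] (X : Set ℝ) (hX : X.Countable)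
    (A : Set N) (f : (N → Pref X) → ℝ) (hSP : StrategyProof X A f) :
    GroupStrategyProof X A f := by
  exact GSP.main hSP
end
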